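/- arXiv:1002.3627 — 8 statements merged into one kernel-verified Lean document; each statement's English description precedes it below -/
import Mathlib

section
/- Fix T ∈ ℕ. Let Q̄ be a probability measure on (Ω̄, ℱ̄) with Q̄ ≪ P̄. Then there exist a probability measure Q on (Ω, ℱ_T) with Q ≪ P on ℱ_T and a nonnegative adapted process γ = (γ_t)_{t=0}^T (each γ_t being ℱ_t-measurable) with ∑_{t=0}^T γ_t = 1 Q-a.s., such that ∫ X dQ̄ = E_Q[∑_{t=0}^T γ_t X_t] for every bounded ℱ̄-measurable function X on Ω̄, where X_t(ω) := X(ω,t). Conversely, for every such pair (Q, γ), the formula ∫ X dQ̄ := E_Q[∑_{t=0}^T γ_t X_t] defines a probability measure Q̄ on (Ω̄, ℱ̄) with Q̄ ≪ P̄. -/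
open MeasureTheory Filter

/-- The optional σ-field `ℱ̄` on `Ω̄ = Ω × {0,…,T}`, generated by the sets `A × {t}` with
`A ∈ ℱ_t`. -/
def optionalSigmaFin {Ω : Type*} {m : MeasurableSpace Ω} (F : Filtration ℕ m) (T : ℕ) :
    MeasurableSpace (Ω × Fin (T + 1)) :=
  MeasurableSpace.generateFrom
    {B | ∃ (t : Fin (T + 1)) (A : Set Ω),
      MeasurableSet[F (t : ℕ)] A ∧ B = A ×ˢ ({t} : Set (Fin (T + 1)))}

open scoped NNReal ENNReal

lemma measurable_indicator_one {Ω : Type*} {m : MeasurableSpace Ω} {s : Set Ω}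
    (hs : MeasurableSet s) : Measurable (s.indicator (1 : Ω → ℝ≥0∞)) :=
  measurable_one.indicator hs

/-- A finite density has a conditional expectation with respect to a sub-σ-field, in the sense
of integrals against nonnegative test functions. -/
lemma exists_measurable_lintegral_mul_eq {Ω : Type*} {m₀ m : MeasurableSpace Ω} (hm : m₀ ≤ m)
    (P : Measure Ω) [IsFiniteMeasure P] {a : Ω → ℝ≥0} (ha : Measurable a)
    (ha_fin : ∫⁻ ω, a ω ∂P ≠ ∞) :
    ∃ b : Ω → ℝ≥0, Measurable[m₀] b ∧ ∀ g : Ω → ℝ≥0∞, Measurable[m₀] g →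
      ∫⁻ ω, g ω * a ω ∂P = ∫⁻ ω, g ω * b ω ∂P := by
  set ν : Measure Ω := P.withDensity fun ω => (a ω : ℝ≥0∞) with hν
  have : IsFiniteMeasure ν := isFiniteMeasure_withDensity ha_fin
  have hac : ν.trim hm ≪ P.trim hm := (withDensity_absolutelyContinuous P _).trim hm
  have hZ : Measurable[m₀] ((ν.trim hm).rnDeriv (P.trim hm)) := Measure.measurable_rnDeriv _ _
  refine ⟨fun ω => ((ν.trim hm).rnDeriv (P.trim hm) ω).toNNReal, hZ.ennreal_toNNReal,
    fun g hg => ?_⟩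
  have hlt : ∀ᵐ ω ∂P, (ν.trim hm).rnDeriv (P.trim hm) ω < ∞ :=
    ae_of_ae_trim hm (Measure.rnDeriv_lt_top _ _)
  calc ∫⁻ ω, g ω * a ω ∂P = ∫⁻ ω, g ω ∂ν := by
        rw [hν, lintegral_withDensity_eq_lintegral_mul _ ha.coe_nnreal_ennreal (hg.mono hm le_rfl)]
        simp [mul_comm]
    _ = ∫⁻ ω, g ω ∂ν.trim hm := (lintegral_trim hm hg).symm
    _ = ∫⁻ ω, (ν.trim hm).rnDeriv (P.trim hm) ω * g ω ∂P.trim hm :=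
        (lintegral_rnDeriv_mul hac hg.aemeasurable).symm
    _ = ∫⁻ ω, (ν.trim hm).rnDeriv (P.trim hm) ω * g ω ∂P := lintegral_trim hm (hZ.mul hg)
    _ = _ := by
        refine lintegral_congr_ae ?_
        filter_upwards [hlt] with ω hω
        rw [ENNReal.coe_toNNReal hω.ne, mul_comm]

/-- Functions measurable for a sub-σ-field agree almost everywhere as soon as their integrals
against all nonnegative test functions of that σ-field agree. -/
lemma ae_eq_of_forall_lintegral_mul_eq {Ω : Type*} {m₀ m : MeasurableSpace Ω} (hm : m₀ ≤ m)
    (P : Measure Ω) [IsFiniteMeasure P] {u v : Ω → ℝ≥0∞}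
    (hu : Measurable[m₀] u) (hv : Measurable[m₀] v)
    (h : ∀ g : Ω → ℝ≥0∞, Measurable[m₀] g → ∫⁻ ω, g ω * u ω ∂P = ∫⁻ ω, g ω * v ω ∂P) :
    u =ᵐ[P] v := by
  refine ae_eq_of_ae_eq_trim (hm := hm)
    (ae_eq_of_forall_setLIntegral_eq_of_sigmaFinite hu hv fun s hs _ => ?_)
  have key : ∀ w : Ω → ℝ≥0∞, Measurable[m₀] w →
      ∫⁻ ω in s, w ω ∂P.trim hm = ∫⁻ ω, s.indicator 1 ω * w ω ∂P := by
    intro w hw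
    rw [← @lintegral_indicator _ m₀ _ _ hs, lintegral_trim hm (hw.indicator hs)]
    refine lintegral_congr fun ω => ?_
    by_cases hω : ω ∈ s <;> simp [hω]
  rw [key u hu, key v hv, h _ (measurable_indicator_one hs)]

/-- Multiplicative (Itô–Watanabe type) decomposition: an adapted nonnegative integrable process
`a` is, up to integration against adapted test functions, of the form `γ t * f` with `γ` adapted
and summing to one and `f` measurable at the terminal time. -/
lemma exists_multiplicative_decomposition {Ω : Type*} {m : MeasurableSpace Ω}
    (F : Filtration ℕ m) (P : Measure Ω) [IsFiniteMeasure P] (T : ℕ) :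
    ∀ a : ℕ → Ω → ℝ≥0, (∀ t, Measurable[F t] (a t)) → (∀ t, ∫⁻ ω, a t ω ∂P ≠ ∞) →
    ∃ (f : Ω → ℝ≥0) (γ : ℕ → Ω → ℝ≥0), Measurable[F T] f ∧ (∀ t, Measurable[F t] (γ t)) ∧
      (∀ ω, ∑ t ∈ Finset.range (T + 1), γ t ω = 1) ∧
      ∀ t ≤ T, ∀ g : Ω → ℝ≥0∞, Measurable[F t] g →
        ∫⁻ ω, g ω * (γ t ω * f ω) ∂P = ∫⁻ ω, g ω * a t ω ∂P := by
  induction T with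
  | zero =>
    intro a ha _
    refine ⟨a 0, fun _ _ => 1, ha 0, fun t => measurable_const, by simp, fun t ht g _ => ?_⟩
    obtain rfl : t = 0 := by omega
    simp
  | succ T ih =>
    intro a ha ha_fin
    obtain ⟨b, hb, hab⟩ := exists_measurable_lintegral_mul_eq (F.le T) P
      ((ha (T + 1)).mono (F.le _) le_rfl) (ha_fin (T + 1))
    obtain ⟨f', γ', hf', hγ', hsum, hdec⟩ := ih (fun t => if t = T then a T + b else a t)
      (fun t => by
        split_ifs with h
        · subst h; exact (ha _).add hb
        · exact ha t)
      (fun t => by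
        split_ifs with h
        · simp only [Pi.add_apply, ENNReal.coe_add]
          rw [lintegral_add_right _ (hb.mono (F.le T) le_rfl).coe_nnreal_ennreal]
          refine ENNReal.add_ne_top.2 ⟨ha_fin T, ?_⟩
          have := hab (fun _ => 1) measurable_const
          simp only [one_mul] at this
          exact this ▸ ha_fin (T + 1)
        · exact ha_fin t)
    have hdecT : ∀ g : Ω → ℝ≥0∞, Measurable[F T] g →
        ∫⁻ ω, g ω * (γ' T ω * f' ω) ∂P = ∫⁻ ω, g ω * (a T ω + b ω) ∂P := by
      intro g hg
      simpa using hdec T le_rfl g hg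
    have hae : (fun ω => (γ' T ω * f' ω : ℝ≥0∞)) =ᵐ[P] fun ω => (a T ω + b ω : ℝ≥0∞) :=
      ae_eq_of_forall_lintegral_mul_eq (F.le T) P
        ((hγ' T).coe_nnreal_ennreal.mul hf'.coe_nnreal_ennreal)
        ((ha T).coe_nnreal_ennreal.add hb.coe_nnreal_ennreal) hdecT
    have hb0 : MeasurableSet[F T] {ω | b ω = 0} := hb (measurableSet_singleton 0)
    have ha0 : ∀ᵐ ω ∂P, b ω = 0 → a (T + 1) ω = 0 := by
      have h0 := hab ({ω | b ω = 0}.indicator 1) (measurable_indicator_one hb0)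
      have h1 : ∫⁻ ω, {ω | b ω = 0}.indicator 1 ω * (b ω : ℝ≥0∞) ∂P = 0 := by
        rw [← lintegral_zero (μ := P)]
        refine lintegral_congr fun ω => ?_
        by_cases hω : b ω = 0 <;> simp [hω]
      rw [h1] at h0
      replace h0 := (lintegral_eq_zero_iff (Measurable.mul
        ((measurable_indicator_one hb0).mono (F.le T) le_rfl)
        ((ha (T + 1)).mono (F.le _) le_rfl).coe_nnreal_ennreal)).1 h0
      filter_upwards [h0] with ω hω hbω
      simpa [hbω] using hω
    set h : Ω → ℝ≥0 := fun ω => f' ω / b ω with h_def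
    set k : Ω → ℝ≥0 := {ω | b ω = 0}.indicator f' with k_def
    set c : Ω → ℝ≥0 := fun ω => a T ω / (a T ω + b ω) with c_def
    have hh : Measurable[F T] h := hf'.div hb
    have hk : Measurable[F T] k := hf'.indicator hb0
    have hc : Measurable[F T] c := (ha T).div ((ha T).add hb)
    have hc1 : ∀ ω, c ω ≤ 1 := fun ω => div_le_one_of_le₀ le_self_add zero_le
    have hf'_eq : ∀ ω, f' ω = h ω * b ω + k ω := by
      intro ω
      by_cases hω : b ω = 0 <;> simp [h_def, k_def, hω]
    have hswap : ∀ g : Ω → ℝ≥0∞, Measurable[F T] g →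
        ∫⁻ ω, g ω * (h ω * a (T + 1) ω + k ω : ℝ≥0) ∂P = ∫⁻ ω, g ω * f' ω ∂P := by
      intro g hg
      have hgk : Measurable fun ω => g ω * (k ω : ℝ≥0∞) :=
        (hg.mul hk.coe_nnreal_ennreal).mono (F.le T) le_rfl
      simp only [hf'_eq, ENNReal.coe_add, ENNReal.coe_mul, mul_add, ← mul_assoc]
      rw [lintegral_add_right _ hgk, lintegral_add_right _ hgk,
        hab (fun ω => g ω * h ω) (hg.mul hh.coe_nnreal_ennreal)]
    have hTT : F T ≤ F (T + 1) := F.mono (Nat.le_succ T)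
    refine ⟨fun ω => h ω * a (T + 1) ω + k ω,
      fun t => if t = T then γ' T * c else if t = T + 1 then γ' T * (1 - c) else γ' t,
      ((hh.mono hTT le_rfl).mul (ha (T + 1))).add (hk.mono hTT le_rfl), fun t => ?_, fun ω => ?_,
      fun t ht g hg => ?_⟩
    · dsimp only
      split_ifs with h1 h2
      · subst h1; exact (hγ' _).mul hc
      · subst h2
        exact ((hγ' T).mul (measurable_const.sub hc)).mono hTT le_rfl
      · exact hγ' t
    · rw [Finset.sum_range_succ, Finset.sum_range_succ, ← hsum ω, Finset.sum_range_succ, add_assoc]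
      congr 1
      · refine Finset.sum_congr rfl fun t ht => ?_
        have := Finset.mem_range.1 ht
        simp [this.ne, (this.trans (Nat.lt_succ_self T)).ne]
      · simp only [if_true, Nat.succ_ne_self, if_false, Pi.mul_apply, Pi.sub_apply, Pi.one_apply]
        rw [← mul_add, add_tsub_cancel_of_le (hc1 ω), mul_one]
    · rcases eq_or_ne t (T + 1) with rfl | ht1
      · refine lintegral_congr_ae ?_
        filter_upwards [hae, ha0] with ω h1 h2
        have h1' : γ' T ω * f' ω = a T ω + b ω := by exact_mod_cast h1
        simp only [Nat.succ_ne_self, if_false, if_true, Pi.mul_apply, Pi.sub_apply, Pi.one_apply]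
        rw [← ENNReal.coe_mul]
        congr 2
        by_cases hbω : b ω = 0
        · rw [h2 hbω]
          by_cases haω : a T ω = 0
          · simpa [c_def, haω, hbω, k_def] using h1'
          · simp [c_def, hbω, div_self haω]
        · have hab0 : a T ω + b ω ≠ 0 := by simp [hbω]
          have hc' : 1 - c ω = b ω / (a T ω + b ω) := by
            refine tsub_eq_of_eq_add ?_
            simp only [c_def]
            rw [← add_div, add_comm, div_self hab0]
          rw [hc']
          simp only [h_def, k_def, Set.indicator, Set.mem_ofPred_eq, hbω, if_false, add_zero]
          calc _ = (γ' T ω * f' ω) / (a T ω + b ω) * (b ω / b ω) * a (T + 1) ω := by ring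
            _ = a (T + 1) ω := by rw [h1', div_self hab0, div_self hbω]; simp
      · rcases eq_or_ne t T with rfl | htT
        · simp only [if_true, Pi.mul_apply, ENNReal.coe_mul, ← mul_assoc]
          rw [hswap (fun ω => g ω * γ' t ω * c ω)
            ((hg.mul (hγ' t).coe_nnreal_ennreal).mul hc.coe_nnreal_ennreal)]
          calc _ = ∫⁻ ω, g ω * c ω * (γ' t ω * f' ω) ∂P := lintegral_congr fun ω => by ring
            _ = ∫⁻ ω, g ω * c ω * (a t ω + b ω) ∂P :=
              hdecT _ (hg.mul hc.coe_nnreal_ennreal)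
            _ = _ := lintegral_congr fun ω => by
              rw [mul_assoc, ← ENNReal.coe_add, ← ENNReal.coe_mul]
              congr 2
              by_cases h0 : a t ω + b ω = 0
              · simp [add_eq_zero.1 h0]
              · simp only [c_def]; exact div_mul_cancel₀ _ h0
        · have htle : t ≤ T := by omega
          simp only [htT, ht1, if_false, ← mul_assoc]
          rw [hswap (fun ω => g ω * γ' t ω)
            ((hg.mul (hγ' t).coe_nnreal_ennreal).mono (F.mono htle) le_rfl)]
          simpa [htT, mul_assoc] using hdec t htle g hg

/-- The measure `X ↦ E_Q[∑ t, w t * X (e t)]`, i.e. the sum of the images under `e t` of the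
measures with density `w t` with respect to `Q`. -/
noncomputable def mixture {Ω E ι : Type*} [Fintype ι] {m : MeasurableSpace Ω}
    [MeasurableSpace E] (Q : Measure Ω) (e : ι → Ω → E) (w : ι → Ω → ℝ≥0) : Measure E :=
  ∑ t, (Q.withDensity fun ω => (w t ω : ℝ≥0∞)).map (e t)

section Mixture

variable {Ω E ι : Type*} [Fintype ι] {m : MeasurableSpace Ω} {mE : MeasurableSpace E}
  {Q : Measure Ω} {e : ι → Ω → E} {w : ι → Ω → ℝ≥0}

lemma lintegral_mixture (he : ∀ t, Measurable (e t)) (hw : ∀ t, Measurable (w t))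
    {X : E → ℝ≥0∞} (hX : Measurable X) :
    ∫⁻ p, X p ∂mixture Q e w = ∑ t, ∫⁻ ω, X (e t ω) * w t ω ∂Q := by
  rw [mixture, lintegral_finsetSum_measure]
  refine Finset.sum_congr rfl fun t _ => ?_
  rw [lintegral_map hX (he t), lintegral_withDensity_eq_lintegral_mul (g := fun ω => X (e t ω)) _
    (hw t).coe_nnreal_ennreal (hX.comp (he t))]
  simp [mul_comm]

lemma integral_mixture (he : ∀ t, Measurable (e t)) (hw : ∀ t, Measurable (w t))
    (hw_fin : ∀ t, ∫⁻ ω, w t ω ∂Q ≠ ∞) {X : E → ℝ} (hX : Measurable X)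
    (hX_bdd : ∃ C : ℝ, ∀ p, |X p| ≤ C) :
    ∫ p, X p ∂mixture Q e w = ∫ ω, ∑ t, (w t ω : ℝ) * X (e t ω) ∂Q := by
  obtain ⟨C, hC⟩ := hX_bdd
  have hfin : ∀ t, IsFiniteMeasure (Q.withDensity fun ω => (w t ω : ℝ≥0∞)) := fun t =>
    isFiniteMeasure_withDensity (hw_fin t)
  have hint : ∀ t, Integrable (fun ω => X (e t ω)) (Q.withDensity fun ω => (w t ω : ℝ≥0∞)) :=
    fun t => Integrable.of_bound (hX.comp (he t)).aestronglyMeasurable C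
      (Eventually.of_forall fun ω => hC _)
  rw [mixture, integral_finsetSum_measure fun t _ =>
    (integrable_map_measure hX.aestronglyMeasurable (he t).aemeasurable).2 (hint t),
    integral_finsetSum (f := fun t ω => (w t ω : ℝ) * X (e t ω)) _ fun t _ =>
      (integrable_withDensity_iff_integrable_smul (hw t)).1 (hint t)]
  refine Finset.sum_congr rfl fun t _ => ?_
  rw [integral_map (he t).aemeasurable hX.aestronglyMeasurable,
    integral_withDensity_eq_integral_smul (hw t)]
  rfl

lemma isProbabilityMeasure_mixture [IsProbabilityMeasure Q] (he : ∀ t, Measurable (e t))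
    (hw : ∀ t, Measurable (w t)) (hsum : ∀ᵐ ω ∂Q, ∑ t, w t ω = 1) :
    IsProbabilityMeasure (mixture Q e w) := by
  refine ⟨?_⟩
  rw [← lintegral_one, lintegral_mixture he hw measurable_const,
    ← lintegral_finsetSum (f := fun t ω => 1 * (w t ω : ℝ≥0∞)) _ fun t _ =>
      measurable_const.mul (hw t).coe_nnreal_ennreal,
    ← measure_univ (μ := Q), ← lintegral_one]
  refine lintegral_congr_ae ?_
  filter_upwards [hsum] with ω hω
  simpa using congrArg ((↑) : ℝ≥0 → ℝ≥0∞) hω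

lemma lintegral_ne_top_of_sum_eq_one [IsProbabilityMeasure Q]
    (hsum : ∀ᵐ ω ∂Q, ∑ t, w t ω = 1) (t : ι) : ∫⁻ ω, w t ω ∂Q ≠ ∞ := by
  refine ((lintegral_mono_ae (g := fun _ => 1) ?_).trans_lt (by simp)).ne
  filter_upwards [hsum] with ω hω
  rw [← ENNReal.coe_one, ← hω]
  exact ENNReal.coe_le_coe.2 (Finset.single_le_sum_of_canonicallyOrdered
    (f := fun t => w t ω) (Finset.mem_univ t))

lemma ext_of_integral_bounded {μ ν : Measure E} [IsFiniteMeasure μ] [IsFiniteMeasure ν]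
    (h : ∀ X : E → ℝ, Measurable X → (∃ C : ℝ, ∀ p, |X p| ≤ C) → ∫ p, X p ∂μ = ∫ p, X p ∂ν) :
    μ = ν := by
  refine Measure.ext fun B hB => ?_
  have := h (B.indicator 1) (measurable_one.indicator hB) ⟨1, fun p => by
    by_cases hp : p ∈ B <;> simp [hp]⟩
  rw [integral_indicator_one hB, integral_indicator_one hB] at this
  exact (measureReal_eq_measureReal_iff).1 this

end Mixture

/-- If `Q ≪ P` on `F T` and the weights `v` are almost surely positive, then every mixture of `Q`
along adapted maps is dominated by the mixture of `P` with weights `v`. -/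
lemma mixture_absolutelyContinuous {Ω E : Type*} {m : MeasurableSpace Ω} {mE : MeasurableSpace E}
    (F : Filtration ℕ m) {T : ℕ} {P Q : Measure Ω} {e : Fin (T + 1) → Ω → E}
    {v w : Fin (T + 1) → Ω → ℝ≥0} (he : ∀ t : Fin (T + 1), Measurable[F t] (e t))
    (hv : ∀ t, Measurable (v t)) (hw : ∀ t, Measurable (w t))
    (hv_pos : ∀ t, ∀ᵐ ω ∂P, 0 < v t ω)
    (hQP : ∀ A : Set Ω, MeasurableSet[F T] A → P A = 0 → Q A = 0) :
    mixture Q e w ≪ mixture P e v := by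
  have he' : ∀ t, Measurable (e t) := fun t => (he t).mono (F.le _) le_rfl
  refine Measure.AbsolutelyContinuous.mk fun B hB hPB => ?_
  rw [← lintegral_indicator_one hB] at hPB ⊢
  rw [lintegral_mixture he' hv (measurable_one.indicator hB), Finset.sum_eq_zero_iff] at hPB
  rw [lintegral_mixture he' hw (measurable_one.indicator hB), Finset.sum_eq_zero_iff]
  intro t _
  have hPt := hPB t (Finset.mem_univ t)
  replace hPt := (lintegral_eq_zero_iff (((measurable_one.indicator hB).comp (he' t)).mul
    (hv t).coe_nnreal_ennreal)).1 hPt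
  have hP0 : P (e t ⁻¹' B) = 0 := by
    refine measure_eq_zero_iff_ae_notMem.2 ?_
    filter_upwards [hPt, hv_pos t] with ω h1 h2 hω
    have : e t ω ∈ B := hω
    simp [this, h2.ne'] at h1
  have hQ0 := hQP _ (F.mono (Nat.lt_succ_iff.1 t.2) _ (he t hB)) hP0
  rw [← lintegral_zero (μ := Q)]
  refine lintegral_congr_ae ?_
  filter_upwards [measure_eq_zero_iff_ae_notMem.1 hQ0] with ω hω
  have : e t ω ∉ B := hω
  simp [this]

/-- Every probability measure dominated by a mixture of adapted maps is itself such a mixture, with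
adapted weights summing to one. -/
lemma exists_eq_mixture {Ω E : Type*} {m : MeasurableSpace Ω} {mE : MeasurableSpace E}
    (F : Filtration ℕ m) {T : ℕ} {P : Measure Ω} [IsFiniteMeasure P] {e : Fin (T + 1) → Ω → E}
    {v : Fin (T + 1) → Ω → ℝ≥0} (he : ∀ t : Fin (T + 1), Measurable[F t] (e t))
    (hv : ∀ t : Fin (T + 1), Measurable[F t] (v t))
    {Pbar Qbar : Measure E} [SigmaFinite Pbar] [IsProbabilityMeasure Qbar]
    (hPbar : Pbar = mixture P e v) (hac : Qbar ≪ Pbar) :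
    ∃ (Q : Measure Ω) (w : Fin (T + 1) → Ω → ℝ≥0), IsProbabilityMeasure Q ∧ Q ≪ P ∧
      (∀ t : Fin (T + 1), Measurable[F t] (w t)) ∧ (∀ ω, ∑ t, w t ω = 1) ∧
      Qbar = mixture Q e w := by
  have he' : ∀ t, Measurable (e t) := fun t => (he t).mono (F.le _) le_rfl
  have hv' : ∀ t, Measurable (v t) := fun t => (hv t).mono (F.le _) le_rfl
  set Z : E → ℝ≥0 := fun p => (Qbar.rnDeriv Pbar p).toNNReal with Z_def
  have hZ : Measurable Z := (Measure.measurable_rnDeriv _ _).ennreal_toNNReal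
  have hQbar : ∀ X : E → ℝ≥0∞, Measurable X →
      ∫⁻ p, X p ∂Qbar = ∑ t, ∫⁻ ω, X (e t ω) * (Z (e t ω) * v t ω : ℝ≥0) ∂P := by
    intro X hX
    have h1 : ∫⁻ p, X p ∂Qbar = ∫⁻ p, X p * Z p ∂Pbar := by
      rw [← lintegral_rnDeriv_mul hac hX.aemeasurable]
      refine lintegral_congr_ae ?_
      filter_upwards [Measure.rnDeriv_lt_top Qbar Pbar] with p hp
      rw [Z_def, ENNReal.coe_toNNReal hp.ne, mul_comm]
    rw [h1, hPbar, lintegral_mixture (X := fun p => X p * Z p) he' hv'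
      (hX.mul hZ.coe_nnreal_ennreal)]
    simp only [ENNReal.coe_mul, mul_assoc]
  set a : ℕ → Ω → ℝ≥0 := fun n =>
    if h : n < T + 1 then fun ω => Z (e ⟨n, h⟩ ω) * v ⟨n, h⟩ ω else 0 with a_def
  have ha_fin_eq : ∀ (t : Fin (T + 1)) (ω : Ω), a t ω = Z (e t ω) * v t ω := by
    intro t ω
    simp [a_def, Nat.lt_succ_iff.1 t.2]
  have hQbar' : ∀ X : E → ℝ≥0∞, Measurable X →
      ∫⁻ p, X p ∂Qbar = ∑ t : Fin (T + 1), ∫⁻ ω, X (e t ω) * a t ω ∂P := by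
    simpa only [ha_fin_eq] using hQbar
  have hmass : ∑ t : Fin (T + 1), ∫⁻ ω, a t ω ∂P = 1 := by
    simpa using (hQbar' 1 measurable_one).symm
  obtain ⟨f, γ, hf, hγ, hsum, hdec⟩ := exists_multiplicative_decomposition F P T a
    (fun n => by
      by_cases h : n < T + 1
      · simp only [a_def, h, dif_pos]
        exact (hZ.comp (he ⟨n, h⟩)).mul (hv ⟨n, h⟩)
      · simp only [a_def, h, dif_neg, not_false_eq_true]
        exact measurable_const)
    (fun n => by
      by_cases h : n < T + 1
      · exact ((ENNReal.sum_lt_top.1 (hmass ▸ ENNReal.one_lt_top)) ⟨n, h⟩ (Finset.mem_univ _)).ne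
      · simp only [a_def, h, dif_neg, not_false_eq_true]
        simp)
  have hf' : Measurable f := hf.mono (F.le _) le_rfl
  have hγ' : ∀ t, Measurable (γ t) := fun t => (hγ t).mono (F.le _) le_rfl
  have hQbar_eq : Qbar = mixture (P.withDensity fun ω => (f ω : ℝ≥0∞)) e
      fun t : Fin (T + 1) => γ t := by
    refine Measure.ext fun B hB => ?_
    have hX : Measurable (B.indicator (1 : E → ℝ≥0∞)) := measurable_one.indicator hB
    rw [← lintegral_indicator_one hB, ← lintegral_indicator_one hB, hQbar' _ hX,
      lintegral_mixture he' (fun t => hγ' t) hX]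
    refine Finset.sum_congr rfl fun t _ => ?_
    rw [← hdec t (Nat.lt_succ_iff.1 t.2) (fun ω => B.indicator 1 (e t ω)) (hX.comp (he t)),
      lintegral_withDensity_eq_lintegral_mul
        (g := fun ω => B.indicator 1 (e t ω) * (γ t ω : ℝ≥0∞)) _ hf'.coe_nnreal_ennreal
        ((hX.comp (he' t)).mul (hγ' t).coe_nnreal_ennreal)]
    refine lintegral_congr fun ω => ?_
    simp only [Pi.mul_apply]
    ring
  have hsum' : ∀ ω, ∑ t : Fin (T + 1), γ t ω = 1 := fun ω => by
    rw [Fin.sum_univ_eq_sum_range fun n => γ n ω, hsum ω]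
  refine ⟨P.withDensity fun ω => (f ω : ℝ≥0∞), fun t => γ t, ⟨?_⟩,
    withDensity_absolutelyContinuous _ _, fun t => hγ t, hsum', hQbar_eq⟩
  have h1 : ∫⁻ _, 1 ∂Qbar = 1 := by simp
  rw [hQbar_eq, lintegral_mixture he' (fun t => hγ' t) measurable_const,
    ← lintegral_finsetSum (f := fun (t : Fin (T + 1)) ω => 1 * (γ t ω : ℝ≥0∞)) _ fun t _ =>
      measurable_const.mul (hγ' t).coe_nnreal_ennreal] at h1
  rw [← h1, ← lintegral_one]
  refine lintegral_congr fun ω => ?_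
  simpa using (congrArg ((↑) : ℝ≥0 → ℝ≥0∞) (hsum' ω)).symm

lemma measurable_prodMk_optionalSigmaFin {Ω : Type*} {m : MeasurableSpace Ω} (F : Filtration ℕ m)
    (T : ℕ) (t : Fin (T + 1)) :
    Measurable[F t, optionalSigmaFin F T] fun ω : Ω => (ω, t) := by
  refine @measurable_generateFrom _ _ (F t) _ _ ?_
  rintro _ ⟨s, A, hA, rfl⟩
  by_cases hst : t = s
  · subst hst
    convert hA using 1
    ext ω
    simp
  · convert @MeasurableSet.empty _ (F t) using 1
    ext ω
    simp [hst]

/-- **Decomposition of measures on the optional σ-field (finite horizon `T`).**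
Every probability measure `Q̄ ≪ P̄` on `(Ω̄, ℱ̄)` decomposes as `Q̄ = Q ⊗ γ` with `Q ≪ P` on
`ℱ_T` and `γ` a nonnegative adapted process with `∑_{t=0}^T γ_t = 1` `Q`-a.s., in the
sense that `∫ X dQ̄ = E_Q[∑_{t=0}^T γ_t X_t]` for every bounded `ℱ̄`-measurable `X`;
conversely every such pair `(Q, γ)` defines a probability measure `Q̄ ≪ P̄` via this
formula. -/
theorem stmt_0 {Ω : Type*} {m : MeasurableSpace Ω} (F : Filtration ℕ m)
    (P : Measure Ω) [IsProbabilityMeasure P]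
    (hF0 : ∀ A : Set Ω, MeasurableSet[F 0] A → P A = 0 ∨ P A = 1)
    (T : ℕ) (μ : Fin (T + 1) → Ω → ℝ)
    (hμ_meas : ∀ t : Fin (T + 1), Measurable[F (t : ℕ)] (μ t))
    (hμ_pos : ∀ t : Fin (T + 1), ∀ᵐ ω ∂P, 0 < μ t ω)
    (hμ_sum : ∀ᵐ ω ∂P, ∑ t : Fin (T + 1), μ t ω = 1)
    (Pbar : @Measure (Ω × Fin (T + 1)) (optionalSigmaFin F T))
    (hPbar_prob : IsProbabilityMeasure Pbar)
    (hPbar : ∀ X : Ω × Fin (T + 1) → ℝ, Measurable[optionalSigmaFin F T] X →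
      (∃ C : ℝ, ∀ p, |X p| ≤ C) →
      ∫ p, X p ∂Pbar = ∫ ω, ∑ t : Fin (T + 1), X (ω, t) * μ t ω ∂P)
    (Qbar : @Measure (Ω × Fin (T + 1)) (optionalSigmaFin F T))
    (hQbar_prob : IsProbabilityMeasure Qbar)
    (hQbar_ac : Qbar ≪ Pbar) :
    (∃ (Q : Measure Ω) (γ : Fin (T + 1) → Ω → ℝ),
      IsProbabilityMeasure Q ∧
      (∀ A : Set Ω, MeasurableSet[F T] A → P A = 0 → Q A = 0) ∧
      (∀ t : Fin (T + 1), Measurable[F (t : ℕ)] (γ t)) ∧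
      (∀ t ω, 0 ≤ γ t ω) ∧
      (∀ᵐ ω ∂Q, ∑ t : Fin (T + 1), γ t ω = 1) ∧
      (∀ X : Ω × Fin (T + 1) → ℝ, Measurable[optionalSigmaFin F T] X →
        (∃ C : ℝ, ∀ p, |X p| ≤ C) →
        ∫ p, X p ∂Qbar = ∫ ω, ∑ t : Fin (T + 1), γ t ω * X (ω, t) ∂Q)) ∧
    (∀ (Q : Measure Ω) (γ : Fin (T + 1) → Ω → ℝ),
      IsProbabilityMeasure Q →
      (∀ A : Set Ω, MeasurableSet[F T] A → P A = 0 → Q A = 0) →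
      (∀ t : Fin (T + 1), Measurable[F (t : ℕ)] (γ t)) →
      (∀ t ω, 0 ≤ γ t ω) →
      (∀ᵐ ω ∂Q, ∑ t : Fin (T + 1), γ t ω = 1) →
      ∃ Qbar' : @Measure (Ω × Fin (T + 1)) (optionalSigmaFin F T),
        IsProbabilityMeasure Qbar' ∧ Qbar' ≪ Pbar ∧
        ∀ X : Ω × Fin (T + 1) → ℝ, Measurable[optionalSigmaFin F T] X →
          (∃ C : ℝ, ∀ p, |X p| ≤ C) →
          ∫ p, X p ∂Qbar' = ∫ ω, ∑ t : Fin (T + 1), γ t ω * X (ω, t) ∂Q) := by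
  have he : ∀ t : Fin (T + 1), Measurable[F t, optionalSigmaFin F T] fun ω : Ω => (ω, t) :=
    measurable_prodMk_optionalSigmaFin F T
  have he' : ∀ t : Fin (T + 1), Measurable[m, optionalSigmaFin F T] fun ω : Ω => (ω, t) :=
    fun t => (he t).mono (F.le _) le_rfl
  set v : Fin (T + 1) → Ω → ℝ≥0 := fun t ω => (μ t ω).toNNReal with v_def
  have hv : ∀ t : Fin (T + 1), Measurable[F t] (v t) := fun t => (hμ_meas t).real_toNNReal
  have hv' : ∀ t, Measurable (v t) := fun t => (hv t).mono (F.le _) le_rfl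
  have hv_pos : ∀ t, ∀ᵐ ω ∂P, 0 < v t ω := fun t => by
    filter_upwards [hμ_pos t] with ω hω
    exact Real.toNNReal_pos.2 hω
  have hv_coe : ∀ᵐ ω ∂P, ∀ t, (v t ω : ℝ) = μ t ω := by
    filter_upwards [ae_all_iff.2 hμ_pos] with ω hω t
    exact Real.coe_toNNReal _ (hω t).le
  have hv_sum : ∀ᵐ ω ∂P, ∑ t, v t ω = 1 := by
    filter_upwards [hv_coe, hμ_sum] with ω h1 h2
    rw [← NNReal.coe_inj]
    push_cast
    simp only [h1, h2]
  have hPbar_eq : Pbar = @mixture _ _ _ _ _ (optionalSigmaFin F T) P (fun t ω => (ω, t)) v := by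
    have := isProbabilityMeasure_mixture (Q := P) he' hv' hv_sum
    refine ext_of_integral_bounded fun X hX hX_bdd => ?_
    rw [hPbar X hX hX_bdd,
      integral_mixture he' hv' (lintegral_ne_top_of_sum_eq_one hv_sum) hX hX_bdd]
    refine integral_congr_ae ?_
    filter_upwards [hv_coe] with ω hω
    simp only [hω, mul_comm]
  refine ⟨?_, fun Q γ hQ hQP hγ hγ0 hγ_sum => ?_⟩
  · obtain ⟨Q, w, hQ, hQP, hw, hw_sum, hQbar⟩ := exists_eq_mixture F he hv hPbar_eq hQbar_ac
    have hw' : ∀ t, Measurable (w t) := fun t => (hw t).mono (F.le _) le_rfl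
    refine ⟨Q, fun t ω => w t ω, hQ, fun A _ hA => hQP hA, fun t => (hw t).coe_nnreal_real,
      fun t ω => (w t ω).2, ae_of_all _ fun ω => by
        simpa using congrArg ((↑) : ℝ≥0 → ℝ) (hw_sum ω),
      fun X hX hX_bdd => ?_⟩
    rw [hQbar]
    exact integral_mixture he' hw' (lintegral_ne_top_of_sum_eq_one (ae_of_all _ hw_sum)) hX hX_bdd
  · lift γ to Fin (T + 1) → Ω → ℝ≥0 using hγ0
    have hw' : ∀ t, Measurable (γ t) := fun t => by
      simpa using ((hγ t).mono (F.le _) le_rfl).real_toNNReal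
    have hw_sum : ∀ᵐ ω ∂Q, ∑ t, γ t ω = 1 := by
      filter_upwards [hγ_sum] with ω hω
      exact_mod_cast hω
    refine ⟨@mixture _ _ _ _ _ (optionalSigmaFin F T) Q (fun t ω => (ω, t)) γ,
      isProbabilityMeasure_mixture he' hw' hw_sum, ?_, fun X hX hX_bdd =>
        integral_mixture he' hw' (lintegral_ne_top_of_sum_eq_one hw_sum) hX hX_bdd⟩
    rw [hPbar_eq]
    exact mixture_absolutelyContinuous F he hv' hw' hv_pos hQP
end

section
/- Let Q̄ be a probability measure on (Ω̄, ℱ̄) with Q̄ ≪ P̄, where Ω̄ = Ω × ℕ. Then there exist a nonnegative P-martingale M = (M_t)_{t∈ℕ} with M_0 = 1 and a process D = (D_t)_{t∈ℕ} with D_0 = 1, 0 ≤ D_{t+1} ≤ D_t, and D_{t+1} ℱ_t-measurable for every t (i.e. D is predictable and non-increasing), such that lim_{t→∞} E_P[M_t D_t] = 0 and ∫ X dQ̄ = ∑_{t=0}^∞ E_P[M_t (D_t − D_{t+1}) X_t] for every bounded ℱ̄-measurable function X on Ω̄, where X_t(ω) := X(ω,t). (Here M is the density process of the locally absolutely continuous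 component Q of the decomposition Q̄ = Q ⊗ D, and D is the predictable discounting process; the condition lim_t E_P[M_t D_t] = 0 expresses that the associated optional random measure γ_t = D_t − D_{t+1} satisfies ∑_t γ_t = 1 Q-a.s.) -/
open MeasureTheory Filter

/-- The optional σ-field `ℱ̄` on `Ω̄ = Ω × ℕ`, generated by the sets `A × {t}` with
`A ∈ ℱ_t`. -/
def optionalSigma {Ω : Type*} {m : MeasurableSpace Ω} (F : Filtration ℕ m) :
    MeasurableSpace (Ω × ℕ) :=
  MeasurableSpace.generateFrom
    {B | ∃ (t : ℕ) (A : Set Ω), MeasurableSet[F t] A ∧ B = A ×ˢ ({t} : Set ℕ)}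

open scoped ENNReal

/-- Two functions with the same integrals over all sets of a sub-σ-field have the same integrals
against every nonnegative function measurable with respect to it. -/
lemma lintegral_mul_eq_of_forall_setLIntegral_eq {Ω : Type*} {m₀ m : MeasurableSpace Ω}
    (hm : m₀ ≤ m) {P : Measure Ω} {f g k : Ω → ℝ≥0∞} (hf : Measurable f) (hg : Measurable g)
    (h : ∀ B, MeasurableSet[m₀] B → ∫⁻ ω in B, f ω ∂P = ∫⁻ ω in B, g ω ∂P)
    (hk : Measurable[m₀] k) :
    ∫⁻ ω, k ω * f ω ∂P = ∫⁻ ω, k ω * g ω ∂P := by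
  have htrim : (P.withDensity f).trim hm = (P.withDensity g).trim hm := by
    refine @Measure.ext _ m₀ _ _ fun B hB => ?_
    rw [trim_measurableSet_eq hm hB, trim_measurableSet_eq hm hB,
      withDensity_apply _ (hm B hB), withDensity_apply _ (hm B hB), h B hB]
  have key : ∀ u : Ω → ℝ≥0∞, Measurable u →
      ∫⁻ ω, k ω * u ω ∂P = ∫⁻ ω, k ω ∂(P.withDensity u) := by
    intro u hu
    rw [lintegral_withDensity_eq_lintegral_mul _ hu (hk.mono hm le_rfl)]
    simp only [Pi.mul_apply, mul_comm]
  rw [key f hf, key g hg, ← lintegral_trim hm hk, ← lintegral_trim hm hk, htrim]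

lemma ae_eq_of_forall_setLIntegral_ofReal_eq {Ω : Type*} {m₀ m : MeasurableSpace Ω}
    (hm : m₀ ≤ m) {P : Measure Ω} [IsFiniteMeasure P] {f g : Ω → ℝ}
    (hf : Measurable[m₀] f) (hg : Measurable[m₀] g) (hf0 : ∀ ω, 0 ≤ f ω) (hg0 : ∀ ω, 0 ≤ g ω)
    (h : ∀ B, MeasurableSet[m₀] B →
      ∫⁻ ω in B, ENNReal.ofReal (f ω) ∂P = ∫⁻ ω in B, ENNReal.ofReal (g ω) ∂P) :
    f =ᵐ[P] g := by
  have hae : (fun ω => ENNReal.ofReal (f ω)) =ᵐ[P] fun ω => ENNReal.ofReal (g ω) := by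
    refine ae_eq_of_ae_eq_trim (hm := hm) ?_
    refine @ae_eq_of_forall_setLIntegral_eq_of_sigmaFinite _ m₀ (P.trim hm) _ _ _
      hf.ennreal_ofReal hg.ennreal_ofReal fun B hB _ => ?_
    rw [setLIntegral_trim hm hf.ennreal_ofReal hB, setLIntegral_trim hm hg.ennreal_ofReal hB,
      h B hB]
  filter_upwards [hae] with ω hω
  exact (ENNReal.ofReal_eq_ofReal_iff (hf0 ω) (hg0 ω)).1 hω

/-- A set function which is a finite measure on a sub-σ-field, absolutely continuous with respect
to `P`, has a nonnegative real density measurable with respect to that sub-σ-field. -/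
lemma exists_measurable_density {Ω : Type*} {m₀ m : MeasurableSpace Ω}
    (hm : m₀ ≤ m) {P : Measure Ω} [IsFiniteMeasure P] (ν : @Measure Ω m₀)
    (hν : ν Set.univ ≠ ∞) (hac : ∀ B, MeasurableSet[m₀] B → P B = 0 → ν B = 0) :
    ∃ f : Ω → ℝ, Measurable[m₀] f ∧ (∀ ω, 0 ≤ f ω) ∧
      ∀ B, MeasurableSet[m₀] B → ∫⁻ ω in B, ENNReal.ofReal (f ω) ∂P = ν B := by
  have hfin : IsFiniteMeasure ν := ⟨hν.lt_top⟩
  have hac' : ν ≪ P.trim hm := by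
    refine @Measure.AbsolutelyContinuous.mk _ m₀ _ _ fun B hB hPB => hac B hB ?_
    rwa [trim_measurableSet_eq hm hB] at hPB
  have hmeas : Measurable[m₀] fun ω => (ν.rnDeriv (P.trim hm) ω).toReal :=
    (Measure.measurable_rnDeriv ν (P.trim hm)).ennreal_toReal
  refine ⟨fun ω => (ν.rnDeriv (P.trim hm) ω).toReal, hmeas, fun ω => ENNReal.toReal_nonneg,
    fun B hB => ?_⟩
  rw [← setLIntegral_trim hm hmeas.ennreal_ofReal hB, ← Measure.setLIntegral_rnDeriv hac' B]
  refine lintegral_congr_ae (ae_restrict_of_ae ?_)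
  filter_upwards [Measure.rnDeriv_lt_top ν (P.trim hm)] with ω hω
  exact ENNReal.ofReal_toReal hω.ne

/-- **Multiplicative Doob decomposition.** A nonnegative supermartingale `S` starting at `1` whose
predicted values are `A t = E[S (t + 1) | F t] ≤ S t` factors as a nonnegative martingale times a
predictable non-increasing process. -/
lemma exists_martingale_mul_predictable {Ω : Type*} {m : MeasurableSpace Ω} (F : Filtration ℕ m)
    (P : Measure Ω) [IsProbabilityMeasure P] {S A : ℕ → Ω → ℝ}
    (hS : ∀ t, Measurable[F t] (S t)) (hA : ∀ t, Measurable[F t] (A t))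
    (hS0 : ∀ t ω, 0 ≤ S t ω) (hA0 : ∀ t ω, 0 ≤ A t ω)
    (hinit : ∀ᵐ ω ∂P, S 0 ω = 1) (hAS : ∀ t, ∀ᵐ ω ∂P, A t ω ≤ S t ω)
    (hpred : ∀ t B, MeasurableSet[F t] B →
      ∫⁻ ω in B, ENNReal.ofReal (S (t + 1) ω) ∂P = ∫⁻ ω in B, ENNReal.ofReal (A t ω) ∂P) :
    ∃ M D : ℕ → Ω → ℝ,
      Martingale M F P ∧ (∀ t ω, 0 ≤ M t ω) ∧ (∀ ω, M 0 ω = 1) ∧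
      (∀ ω, D 0 ω = 1) ∧ (∀ t ω, 0 ≤ D (t + 1) ω) ∧ (∀ t ω, D (t + 1) ω ≤ D t ω) ∧
      (∀ t, Measurable[F t] (D (t + 1))) ∧
      (∀ t, ∀ᵐ ω ∂P, M t ω * D t ω = S t ω) ∧
      ∀ t, ∀ᵐ ω ∂P, M t ω * D (t + 1) ω = A t ω := by
  let r : ℕ → Ω → ℝ := fun t ω => if A t ω = 0 then 1 else S (t + 1) ω / A t ω
  let d : ℕ → Ω → ℝ := fun t ω => min 1 (A t ω / S t ω)
  let M : ℕ → Ω → ℝ := fun t ω => ∏ s ∈ Finset.range t, r s ω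
  let D : ℕ → Ω → ℝ := fun t ω => ∏ s ∈ Finset.range t, d s ω
  have hMsucc : ∀ t ω, M (t + 1) ω = M t ω * r t ω := fun t ω => Finset.prod_range_succ _ _
  have hDsucc : ∀ t ω, D (t + 1) ω = D t ω * d t ω := fun t ω => Finset.prod_range_succ _ _
  have hAzero : ∀ t, MeasurableSet[F t] {ω | A t ω = 0} := fun t =>
    hA t (measurableSet_singleton 0)
  have hr0 : ∀ t ω, 0 ≤ r t ω := by
    intro t ω
    by_cases h : A t ω = 0
    · simp [r, h]
    · simpa [r, h] using div_nonneg (hS0 (t + 1) ω) (hA0 t ω)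
  have hd0 : ∀ t ω, 0 ≤ d t ω := fun t ω =>
    le_min zero_le_one (div_nonneg (hA0 t ω) (hS0 t ω))
  have hM0 : ∀ t ω, 0 ≤ M t ω := fun t ω => Finset.prod_nonneg fun s _ => hr0 s ω
  have hD0 : ∀ t ω, 0 ≤ D t ω := fun t ω => Finset.prod_nonneg fun s _ => hd0 s ω
  have hr_meas : ∀ t, Measurable[F (t + 1)] (r t) := by
    intro t
    have hle : F t ≤ F (t + 1) := F.mono t.le_succ
    exact Measurable.ite (hle _ (hAzero t)) measurable_const
      ((hS (t + 1)).div ((hA t).mono hle le_rfl))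
  have hM_meas : ∀ t, Measurable[F t] (M t) := by
    intro t
    refine Finset.measurable_fun_prod _ fun s hs => ?_
    exact (hr_meas s).mono (F.mono (Finset.mem_range.1 hs)) le_rfl
  have hD_meas : ∀ t, Measurable[F t] (D (t + 1)) := by
    intro t
    refine Finset.measurable_fun_prod _ fun s hs => ?_
    have hle : F s ≤ F t := F.mono (Nat.lt_succ_iff.1 (Finset.mem_range.1 hs))
    exact (measurable_const.min ((hA s).div (hS s))).mono hle le_rfl
  have hstep : ∀ t B, MeasurableSet[F t] B →
      ∫⁻ ω in B, ENNReal.ofReal (M (t + 1) ω) ∂P = ∫⁻ ω in B, ENNReal.ofReal (M t ω) ∂P := by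
    intro t B hB
    let k₀ : Ω → ℝ≥0∞ := fun ω => ENNReal.ofReal (if A t ω = 0 then M t ω else 0)
    let k₁ : Ω → ℝ≥0∞ := fun ω => ENNReal.ofReal (if A t ω = 0 then 0 else M t ω / A t ω)
    have hk₀ : Measurable[F t] k₀ :=
      (Measurable.ite (hAzero t) (hM_meas t) measurable_const).ennreal_ofReal
    have hk₁ : Measurable[F t] k₁ :=
      (Measurable.ite (hAzero t) measurable_const ((hM_meas t).div (hA t))).ennreal_ofReal
    have hnext : ∀ ω, ENNReal.ofReal (M (t + 1) ω) =
        k₀ ω + k₁ ω * ENNReal.ofReal (S (t + 1) ω) := by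
      intro ω
      rw [hMsucc]
      by_cases h : A t ω = 0
      · simp [r, k₀, k₁, h]
      · simp only [r, k₀, k₁, h, if_false, ENNReal.ofReal_zero, zero_add]
        rw [← ENNReal.ofReal_mul (div_nonneg (hM0 t ω) (hA0 t ω))]
        congr 1
        ring
    have hcur : ∀ ω, ENNReal.ofReal (M t ω) = k₀ ω + k₁ ω * ENNReal.ofReal (A t ω) := by
      intro ω
      by_cases h : A t ω = 0
      · simp [k₀, k₁, h]
      · simp only [k₀, k₁, h, if_false, ENNReal.ofReal_zero, zero_add]
        rw [← ENNReal.ofReal_mul (div_nonneg (hM0 t ω) (hA0 t ω)), div_mul_cancel₀ _ h]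
    simp only [hnext, hcur]
    rw [lintegral_add_left (hk₀.mono (F.le t) le_rfl),
      lintegral_add_left (hk₀.mono (F.le t) le_rfl)]
    congr 1
    refine lintegral_mul_eq_of_forall_setLIntegral_eq (F.le t)
      ((hS (t + 1)).mono (F.le _) le_rfl).ennreal_ofReal
      ((hA t).mono (F.le _) le_rfl).ennreal_ofReal (fun C hC => ?_) hk₁
    rw [Measure.restrict_restrict (F.le t C hC)]
    exact hpred t _ (hC.inter hB)
  have hM_lint : ∀ t, ∫⁻ ω, ENNReal.ofReal (M t ω) ∂P = 1 := by
    intro t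
    induction t with
    | zero => simp [M]
    | succ t ih => simpa [ih] using hstep t Set.univ MeasurableSet.univ
  have hM_int : ∀ t, Integrable (M t) P := by
    intro t
    refine ⟨((hM_meas t).mono (F.le t) le_rfl).aestronglyMeasurable, ?_⟩
    rw [hasFiniteIntegral_iff_ofReal (ae_of_all _ (hM0 t)), hM_lint]
    exact ENNReal.one_lt_top
  have hmart : Martingale M F P := by
    refine martingale_of_setIntegral_eq_succ (fun t => (hM_meas t).stronglyMeasurable) hM_int
      fun t B hB => ?_
    rw [integral_eq_lintegral_of_nonneg_ae (ae_of_all _ (hM0 t))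
        (hM_int t).aestronglyMeasurable.restrict,
      integral_eq_lintegral_of_nonneg_ae (ae_of_all _ (hM0 (t + 1)))
        (hM_int (t + 1)).aestronglyMeasurable.restrict, hstep t B hB]
  have hAzero_next : ∀ t, ∀ᵐ ω ∂P, A t ω = 0 → S (t + 1) ω = 0 := by
    intro t
    have hint : ∫⁻ ω in {ω | A t ω = 0}, ENNReal.ofReal (S (t + 1) ω) ∂P = 0 := by
      rw [hpred t _ (hAzero t),
        setLIntegral_congr_fun (g := fun _ => 0) (F.le t _ (hAzero t)) fun ω hω => ?_]
      · simp
      · have : A t ω = 0 := hω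
        simp [this]
    rw [lintegral_eq_zero_iff ((hS (t + 1)).mono (F.le _) le_rfl).ennreal_ofReal,
      EventuallyEq, ae_restrict_iff' (F.le t _ (hAzero t))] at hint
    filter_upwards [hint] with ω hω hAω
    exact le_antisymm (ENNReal.ofReal_eq_zero.1 (hω hAω)) (hS0 _ _)
  have hpredict : ∀ t, ∀ᵐ ω ∂P, M t ω * D t ω = S t ω → M t ω * D (t + 1) ω = A t ω := by
    intro t
    filter_upwards [hAS t] with ω hle h
    rw [hDsucc, ← mul_assoc, h]
    rcases (hS0 t ω).eq_or_lt with hs | hs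
    · have : A t ω = 0 := le_antisymm (hle.trans hs.ge) (hA0 t ω)
      rw [← hs, this, zero_mul]
    · have hmin : d t ω = A t ω / S t ω := min_eq_right ((div_le_one hs).2 hle)
      rw [hmin, mul_div_cancel₀ _ hs.ne']
  have hfactor : ∀ t, ∀ᵐ ω ∂P, M t ω * D t ω = S t ω := by
    intro t
    induction t with
    | zero =>
      filter_upwards [hinit] with ω hω
      simp [M, D, hω]
    | succ t ih =>
      filter_upwards [ih, hpredict t, hAzero_next t] with ω h₁ h₂ h₃
      rw [hMsucc, mul_right_comm, h₂ h₁]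
      by_cases h : A t ω = 0
      · rw [h, zero_mul, h₃ h]
      · simp only [r, h, if_false]
        exact mul_div_cancel₀ _ h
  refine ⟨M, D, hmart, hM0, fun ω => by simp [M], fun ω => by simp [D],
    fun t => hD0 (t + 1), fun t ω => ?_, hD_meas, hfactor, fun t => ?_⟩
  · rw [hDsucc]
    exact mul_le_of_le_one_right (hD0 t ω) (min_le_left _ _)
  · filter_upwards [hfactor t, hpredict t] with ω h₁ h₂ using h₂ h₁

lemma measurableSet_optionalSigma_prod {Ω : Type*} {m : MeasurableSpace Ω} (F : Filtration ℕ m)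
    {t : ℕ} {B : Set Ω} (hB : MeasurableSet[F t] B) {T : Set ℕ} (hT : T ⊆ Set.Ici t) :
    MeasurableSet[optionalSigma F] (B ×ˢ T) := by
  have hUnion : B ×ˢ T = ⋃ s ∈ T, B ×ˢ ({s} : Set ℕ) := by
    ext ⟨ω, s⟩
    simp [and_comm]
  rw [hUnion]
  refine MeasurableSet.biUnion T.to_countable fun s hs => ?_
  exact MeasurableSpace.measurableSet_generateFrom ⟨s, B, F.mono (hT hs) _ hB, rfl⟩

lemma measurable_optionalSigma_section {Ω : Type*} {m : MeasurableSpace Ω} (F : Filtration ℕ m)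
    (t : ℕ) : Measurable[F t, optionalSigma F] fun ω : Ω => (ω, t) := by
  refine @measurable_generateFrom _ _ (F t) _ _ ?_
  rintro _ ⟨s, B, hB, rfl⟩
  rcases eq_or_ne t s with rfl | hne
  · convert hB using 1
    ext ω
    simp
  · convert @MeasurableSet.empty _ (F t) using 1
    ext ω
    simp [hne]

/-- The times in `T` of a measure on the optional σ-field have a density on `F t`, provided `T`
lies after `t`. -/
lemma exists_optional_density {Ω : Type*} {m : MeasurableSpace Ω} (F : Filtration ℕ m)
    (P : Measure Ω) [IsFiniteMeasure P] (Q : @Measure (Ω × ℕ) (optionalSigma F))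
    (hQ : IsProbabilityMeasure Q)
    (hac : ∀ t B, MeasurableSet[F t] B → P B = 0 → Q (B ×ˢ Set.Ici t) = 0)
    {t : ℕ} {T : Set ℕ} (hT : T ⊆ Set.Ici t) :
    ∃ f : Ω → ℝ, Measurable[F t] f ∧ (∀ ω, 0 ≤ f ω) ∧
      ∀ B, MeasurableSet[F t] B → ∫⁻ ω in B, ENNReal.ofReal (f ω) ∂P = Q (B ×ˢ T) := by
  let ν : @Measure Ω (F t) := @Measure.ofMeasurable Ω (F t) (fun B _ => Q (B ×ˢ T)) (by simp) (by
    intro B hB hdisj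
    rw [Set.iUnion_prod_const]
    refine measure_iUnion (fun i j hij => ?_)
      fun i => measurableSet_optionalSigma_prod F (hB i) hT
    exact Set.disjoint_prod.2 (Or.inl (hdisj hij)))
  have hν : ∀ B, MeasurableSet[F t] B → ν B = Q (B ×ˢ T) := fun B hB =>
    @Measure.ofMeasurable_apply Ω (F t) _ _ _ B hB
  obtain ⟨f, hf, hf0, hfν⟩ := exists_measurable_density (P := P) (F.le t) ν
    (by rw [hν _ MeasurableSet.univ]; exact measure_ne_top Q _)
    (fun B hB hPB => by
      rw [hν B hB]
      exact measure_mono_null (Set.prod_mono_right hT) (hac t B hB hPB))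
  exact ⟨f, hf, hf0, fun B hB => (hfν B hB).trans (hν B hB)⟩

lemma integral_mul_section_eq_setIntegral {Ω : Type*} {m : MeasurableSpace Ω} (F : Filtration ℕ m)
    (P : Measure Ω) (Q : @Measure (Ω × ℕ) (optionalSigma F))
    {t : ℕ} {z : Ω → ℝ} (hz : Measurable[F t] z) (hz0 : ∀ ω, 0 ≤ z ω)
    (hzQ : ∀ B, MeasurableSet[F t] B →
      ∫⁻ ω in B, ENNReal.ofReal (z ω) ∂P = Q (B ×ˢ ({t} : Set ℕ)))
    {X : Ω × ℕ → ℝ} (hX : Measurable[optionalSigma F] X) :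
    ∫ ω, z ω * X (ω, t) ∂P = ∫ p in Set.univ ×ˢ ({t} : Set ℕ), X p ∂Q := by
  have hsec := measurable_optionalSigma_section F t
  have hz' : Measurable fun ω => ENNReal.ofReal (z ω) :=
    (hz.mono (F.le t) le_rfl).ennreal_ofReal
  have hmap : Q.restrict (Set.univ ×ˢ ({t} : Set ℕ)) =
      @Measure.map _ _ (F t) (optionalSigma F) (fun ω => (ω, t))
        ((P.withDensity fun ω => ENNReal.ofReal (z ω)).trim (F.le t)) := by
    refine @Measure.ext _ (optionalSigma F) _ _ fun B hB => ?_
    rw [Measure.restrict_apply hB, Measure.map_apply hsec hB,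
      trim_measurableSet_eq (F.le t) (hsec hB), withDensity_apply _ (F.le t _ (hsec hB)),
      hzQ _ (hsec hB)]
    congr 1
    ext ⟨ω, s⟩
    constructor
    · rintro ⟨h, -, rfl⟩
      exact ⟨h, rfl⟩
    · rintro ⟨h, rfl⟩
      exact ⟨h, Set.mem_univ _, rfl⟩
  have hXt : Measurable[F t] fun ω => X (ω, t) := hX.comp hsec
  rw [hmap, @integral_map_of_stronglyMeasurable _ _ _ _ (F t) _ _ (optionalSigma F) _ hsec _
      (@Measurable.stronglyMeasurable _ _ _ (optionalSigma F) _ _ _ _ _ hX),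
    ← integral_trim (F.le t) hXt.stronglyMeasurable,
    integral_withDensity_eq_integral_toReal_smul hz' (ae_of_all _ fun ω => ENNReal.ofReal_lt_top)]
  refine integral_congr_ae (ae_of_all _ fun ω => ?_)
  simp [ENNReal.toReal_ofReal (hz0 ω)]

/-- **Decomposition `Q̄ = Q ⊗ D` of a measure on the optional σ-field (horizon `𝕋 = ℕ`).**
Every probability measure `Q̄ ≪ P̄` on `(Ω̄, ℱ̄)` with `Ω̄ = Ω × ℕ` is of the form
`∫ X dQ̄ = ∑_{t=0}^∞ E_P[M_t (D_t − D_{t+1}) X_t]`, where `M` is a nonnegative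
`P`-martingale with `M_0 = 1` (the density process of the locally absolutely continuous
component `Q`) and `D` is a predictable, nonnegative, non-increasing process with
`D_0 = 1` (the discounting process), and `lim_t E_P[M_t D_t] = 0`. -/
theorem stmt_1 {Ω : Type*} {m : MeasurableSpace Ω} (F : Filtration ℕ m)
    (P : Measure Ω) [IsProbabilityMeasure P]
    (hF0 : ∀ A : Set Ω, MeasurableSet[F 0] A → P A = 0 ∨ P A = 1)
    (μ : ℕ → Ω → ℝ)
    (hμ_meas : ∀ t, Measurable[F t] (μ t))
    (hμ_pos : ∀ t, ∀ᵐ ω ∂P, 0 < μ t ω)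
    (hμ_sum : ∀ᵐ ω ∂P, HasSum (fun t => μ t ω) 1)
    (Pbar : @Measure (Ω × ℕ) (optionalSigma F))
    (hPbar_prob : IsProbabilityMeasure Pbar)
    (hPbar : ∀ X : Ω × ℕ → ℝ, Measurable[optionalSigma F] X →
      (∃ C : ℝ, ∀ p, |X p| ≤ C) →
      ∫ p, X p ∂Pbar = ∫ ω, ∑' t, X (ω, t) * μ t ω ∂P)
    (Qbar : @Measure (Ω × ℕ) (optionalSigma F))
    (hQbar_prob : IsProbabilityMeasure Qbar)
    (hQbar_ac : Qbar ≪ Pbar) :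
    ∃ M D : ℕ → Ω → ℝ,
      Martingale M F P ∧ (∀ t ω, 0 ≤ M t ω) ∧ (∀ ω, M 0 ω = 1) ∧
      (∀ ω, D 0 ω = 1) ∧ (∀ t ω, 0 ≤ D (t + 1) ω) ∧ (∀ t ω, D (t + 1) ω ≤ D t ω) ∧
      (∀ t, Measurable[F t] (D (t + 1))) ∧
      Tendsto (fun t => ∫ ω, M t ω * D t ω ∂P) atTop (nhds 0) ∧
      (∀ X : Ω × ℕ → ℝ, Measurable[optionalSigma F] X →
        (∃ C : ℝ, ∀ p, |X p| ≤ C) →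
        HasSum (fun t => ∫ ω, M t ω * (D t ω - D (t + 1) ω) * X (ω, t) ∂P)
          (∫ p, X p ∂Qbar)) := by
  have hac : ∀ t B, MeasurableSet[F t] B → P B = 0 → Qbar (B ×ˢ Set.Ici t) = 0 := by
    intro t B hB hPB
    have hmeas := measurableSet_optionalSigma_prod F hB subset_rfl
    refine hQbar_ac ?_
    have hind := hPbar ((B ×ˢ Set.Ici t).indicator fun _ => 1)
      (measurable_const.indicator hmeas) ⟨1, fun p => by
        by_cases hp : p ∈ B ×ˢ Set.Ici t <;> simp [hp]⟩
    have hzero : ∫ ω, ∑' s, (B ×ˢ Set.Ici t).indicator (fun _ => (1 : ℝ)) (ω, s) * μ s ω ∂P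
        = 0 := by
      refine integral_eq_zero_of_ae ?_
      filter_upwards [measure_eq_zero_iff_ae_notMem.1 hPB] with ω hω
      simp [hω]
    rw [hzero, integral_indicator hmeas] at hind
    simpa [Measure.real, ENNReal.toReal_eq_zero_iff, measure_ne_top Pbar] using hind
  choose S hS hS0 hSQ using fun t : ℕ =>
    exists_optional_density F P Qbar hQbar_prob hac (subset_refl (Set.Ici t))
  choose A hA hA0 hAQ using fun t : ℕ =>
    exists_optional_density F P Qbar hQbar_prob hac
      (Set.Ici_subset_Ici.2 t.le_succ : Set.Ici (t + 1) ⊆ Set.Ici t)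
  choose z hz hz0 hzQ using fun t : ℕ =>
    exists_optional_density F P Qbar hQbar_prob hac
      (Set.singleton_subset_iff.2 (Set.mem_Ici.2 le_rfl) : ({t} : Set ℕ) ⊆ Set.Ici t)
  have hsplit : ∀ t, S t =ᵐ[P] fun ω => z t ω + A t ω := by
    intro t
    refine ae_eq_of_forall_setLIntegral_ofReal_eq (F.le t) (hS t) ((hz t).add (hA t)) (hS0 t)
      (fun ω => add_nonneg (hz0 t ω) (hA0 t ω)) fun B hB => ?_
    simp only [ENNReal.ofReal_add (hz0 t _) (hA0 t _)]
    rw [lintegral_add_left ((hz t).mono (F.le t) le_rfl).ennreal_ofReal, hSQ t B hB, hzQ t B hB,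
      hAQ t B hB, ← measure_union ?_ (measurableSet_optionalSigma_prod F hB
        (Set.Ici_subset_Ici.2 t.le_succ)), ← Set.prod_union]
    · congr 2
      ext s
      simp only [Set.mem_Ici, Set.mem_union, Set.mem_singleton_iff]
      omega
    · exact Set.disjoint_prod.2 (Or.inr (by simp))
  have hinit : S 0 =ᵐ[P] fun _ => 1 := by
    refine ae_eq_of_forall_setLIntegral_ofReal_eq (F.le 0) (hS 0) measurable_const (hS0 0)
      (fun _ => zero_le_one) fun B hB => ?_
    simp only [ENNReal.ofReal_one, lintegral_const, MeasurableSet.univ, Measure.restrict_apply,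
      Set.univ_inter, one_mul]
    rw [hSQ 0 B hB]
    rcases hF0 B hB with h | h
    · rw [h, hac 0 B hB h]
    · have hc : P Bᶜ = 0 := (prob_compl_eq_zero_iff (F.le 0 B hB)).2 h
      rw [h, ← prob_compl_eq_zero_iff (measurableSet_optionalSigma_prod F hB subset_rfl)]
      refine measure_mono_null ?_ (hac 0 Bᶜ hB.compl hc)
      rintro ⟨ω, s⟩ hp
      exact ⟨fun hω => hp ⟨hω, Nat.zero_le s⟩, Nat.zero_le s⟩
  obtain ⟨M, D, hM, hM0, hM1, hD1, hD0, hDanti, hDmeas, hMD, hMD'⟩ :=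
    exists_martingale_mul_predictable F P hS hA hS0 hA0 hinit
      (fun t => by filter_upwards [hsplit t] with ω hω; linarith [hz0 t ω])
      (fun t B hB => by rw [hSQ (t + 1) B (F.mono t.le_succ B hB), hAQ t B hB])
  refine ⟨M, D, hM, hM0, hM1, hD1, hD0, hDanti, hDmeas, ?_, ?_⟩
  · have hint : ∀ t, ∫ ω, M t ω * D t ω ∂P = (Qbar (Set.univ ×ˢ Set.Ici t)).toReal := by
      intro t
      rw [integral_congr_ae (hMD t), integral_eq_lintegral_of_nonneg_ae (ae_of_all _ (hS0 t))
        ((hS t).mono (F.le t) le_rfl).aestronglyMeasurable, ← hSQ t _ MeasurableSet.univ,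
        Measure.restrict_univ]
    simp only [hint]
    have hlim := tendsto_measure_iInter_atTop (μ := Qbar)
      (s := fun t : ℕ => (Set.univ : Set Ω) ×ˢ Set.Ici t)
      (fun t => (measurableSet_optionalSigma_prod F MeasurableSet.univ
        subset_rfl).nullMeasurableSet)
      (fun s t hst => Set.prod_mono_right (Set.Ici_subset_Ici.2 hst)) ⟨0, measure_ne_top _ _⟩
    have hempty : ⋂ t : ℕ, (Set.univ : Set Ω) ×ˢ Set.Ici t = ∅ := by
      refine Set.eq_empty_of_forall_notMem fun p hp => ?_
      exact absurd (Set.mem_iInter.1 hp (p.2 + 1)).2 (by simp)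
    rw [hempty, measure_empty] at hlim
    exact (ENNReal.tendsto_toReal ENNReal.zero_ne_top).comp hlim
  · rintro X hX ⟨C, hC⟩
    have hterm : ∀ t, ∫ ω, M t ω * (D t ω - D (t + 1) ω) * X (ω, t) ∂P =
        ∫ p in Set.univ ×ˢ ({t} : Set ℕ), X p ∂Qbar := by
      intro t
      rw [← integral_mul_section_eq_setIntegral F P Qbar (hz t) (hz0 t) (hzQ t) hX]
      refine integral_congr_ae ?_
      filter_upwards [hMD t, hMD' t, hsplit t] with ω h₁ h₂ h₃
      rw [mul_sub, h₁, h₂, h₃, add_sub_cancel_right]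
    have hXint : Integrable X Qbar :=
      Integrable.of_bound hX.aestronglyMeasurable C (ae_of_all _ hC)
    have huniv : ⋃ t : ℕ, (Set.univ : Set Ω) ×ˢ ({t} : Set ℕ) = Set.univ := by
      ext p
      simp
    have hsum := hasSum_integral_iUnion (μ := Qbar) (f := X)
      (s := fun t : ℕ => (Set.univ : Set Ω) ×ˢ ({t} : Set ℕ))
      (fun t => measurableSet_optionalSigma_prod F (t := t) MeasurableSet.univ (by simp))
      (fun s t hst => Set.disjoint_prod.2 (Or.inr (by simpa using hst)))
      hXint.integrableOn
    rw [huniv, setIntegral_univ] at hsum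
    simpa only [hterm] using hsum
end

section
/- Let Q be a probability measure on (Ω, σ(∪_t ℱ_t)) with Q ≪ P on ℱ_t for every t ∈ ℕ, with density process M_t := dQ/dP restricted to ℱ_t, and let γ = (γ_t)_{t∈ℕ} be a nonnegative adapted process with ∑_{t=0}^∞ γ_t = 1 Q-a.s. Then the function Z̄(ω,t) := M_t(ω) γ_t(ω) / μ_t(ω) is a nonnegative ℱ̄-measurable function with ∫ Z̄ dP̄ = 1, and the probability measure Q̄ := Z̄ · P̄ on (Ω̄, ℱ̄) satisfies ∫ X dQ̄ = E_Q[∑_{t=0}^∞ γ_t X_t] for every bounded ℱ̄-measurable function X on Ω̄, where X_t(ω) := X(ω,t). In particular, every such pair (Q, γ) defines a probability measure Q̄ = Q ⊗ γ absolutely continuous with respect to P̄, whose density with respect to P̄ is given by Z_t = M_t γ_t / μ_t. -/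
open MeasureTheory Filter

section OptionalMeasure

variable {Ω : Type*} {m : MeasurableSpace Ω} (F : Filtration ℕ m)

theorem measurable_section_optionalSigma (t : ℕ) :
    @Measurable Ω (Ω × ℕ) (F t) (optionalSigma F) (fun ω => (ω, t)) := by
  refine @measurable_generateFrom _ _ (F t) _ _ ?_
  rintro _ ⟨s, A, hA, rfl⟩
  by_cases h : t = s
  · subst h
    convert hA using 1
    ext ω
    simp
  · convert @MeasurableSet.empty _ (F t) using 1
    ext ω
    simp [h]

theorem measurable_optionalSigma_of_sections {β : Type*} [MeasurableSpace β]
    {X : Ω × ℕ → β} (hX : ∀ t, Measurable[F t] fun ω => X (ω, t)) :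
    Measurable[optionalSigma F] X := by
  intro S hS
  have h : X ⁻¹' S = ⋃ t : ℕ, ((fun ω => X (ω, t)) ⁻¹' S) ×ˢ ({t} : Set ℕ) := by
    ext ⟨ω, s⟩
    simp
  rw [h]
  exact @MeasurableSet.iUnion _ _ (optionalSigma F) _ _ fun t =>
    MeasurableSpace.measurableSet_generateFrom ⟨t, _, hX t hS, rfl⟩

/-- The measure `ρ ⊗ γ` on the optional σ-field. -/
noncomputable def optionalMeasure (ρ : Measure Ω) (γ : ℕ → Ω → ℝ) :
    @Measure (Ω × ℕ) (optionalSigma F) :=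
  @Measure.sum _ _ (optionalSigma F) fun t =>
    @Measure.map Ω (Ω × ℕ) m (optionalSigma F) (fun ω => (ω, t))
      (ρ.withDensity fun ω => ENNReal.ofReal (γ t ω))

variable {F}

theorem lintegral_optionalMeasure (ρ : Measure Ω) {γ : ℕ → Ω → ℝ}
    (hγ : ∀ t, Measurable[F t] (γ t)) {f : Ω × ℕ → ENNReal} (hf : Measurable[optionalSigma F] f) :
    ∫⁻ p, f p ∂(optionalMeasure F ρ γ) =
      ∑' t, ∫⁻ ω, ENNReal.ofReal (γ t ω) * f (ω, t) ∂ρ := by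
  let _ : MeasurableSpace (Ω × ℕ) := optionalSigma F
  have hs : ∀ t, @Measurable Ω (Ω × ℕ) m (optionalSigma F) (fun ω => (ω, t)) := fun t =>
    (measurable_section_optionalSigma F t).mono (F.le t) le_rfl
  rw [optionalMeasure, lintegral_sum_measure]
  congr with t
  rw [lintegral_map hf (hs t)]
  exact lintegral_withDensity_eq_lintegral_mul _
    ((hγ t).mono (F.le t) le_rfl).ennreal_ofReal (hf.comp (hs t))

theorem isProbabilityMeasure_optionalMeasure (ρ : Measure Ω) [IsProbabilityMeasure ρ]
    {γ : ℕ → Ω → ℝ} (hγ : ∀ t, Measurable[F t] (γ t)) (hγ_nonneg : ∀ t ω, 0 ≤ γ t ω)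
    (hγ_sum : ∀ᵐ ω ∂ρ, HasSum (fun t => γ t ω) 1) :
    IsProbabilityMeasure (optionalMeasure F ρ γ) := by
  refine ⟨?_⟩
  rw [← lintegral_one, lintegral_optionalMeasure ρ hγ (@measurable_const _ _ _ (optionalSigma F) _),
    ← lintegral_tsum fun t =>
      (((hγ t).mono (F.le t) le_rfl).ennreal_ofReal.mul_const 1).aemeasurable]
  have h : ∀ᵐ ω ∂ρ, ∑' t, ENNReal.ofReal (γ t ω) * 1 = 1 := by
    filter_upwards [hγ_sum] with ω hω
    simp_rw [mul_one]
    rw [← ENNReal.ofReal_tsum_of_nonneg (fun t => hγ_nonneg t ω) hω.summable, hω.tsum_eq,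
      ENNReal.ofReal_one]
  rw [lintegral_congr_ae h]
  simp

theorem integral_optionalMeasure (ρ : Measure Ω) [IsProbabilityMeasure ρ]
    {γ : ℕ → Ω → ℝ} (hγ : ∀ t, Measurable[F t] (γ t)) (hγ_nonneg : ∀ t ω, 0 ≤ γ t ω)
    (hγ_sum : ∀ᵐ ω ∂ρ, HasSum (fun t => γ t ω) 1) {X : Ω × ℕ → ℝ}
    (hX : Measurable[optionalSigma F] X) (hX_bdd : ∃ C : ℝ, ∀ p, |X p| ≤ C) :
    ∫ p, X p ∂(optionalMeasure F ρ γ) = ∫ ω, ∑' t, γ t ω * X (ω, t) ∂ρ := by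
  let _ : MeasurableSpace (Ω × ℕ) := optionalSigma F
  obtain ⟨C, hC⟩ := hX_bdd
  have hprob := isProbabilityMeasure_optionalMeasure ρ hγ hγ_nonneg hγ_sum
  have hs : ∀ t, @Measurable Ω (Ω × ℕ) m (optionalSigma F) (fun ω => (ω, t)) := fun t =>
    (measurable_section_optionalSigma F t).mono (F.le t) le_rfl
  have hγm : ∀ t, Measurable (γ t) := fun t => (hγ t).mono (F.le t) le_rfl
  have hXt : ∀ t, Measurable fun ω => X (ω, t) := fun t => hX.comp (hs t)
  have hint : Integrable X (optionalMeasure F ρ γ) :=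
    Integrable.of_bound hX.aestronglyMeasurable C (Eventually.of_forall hC)
  have hsum := hint
  rw [optionalMeasure] at hsum ⊢
  rw [integral_sum_measure hsum]
  have hterm : ∀ t, ∫ p, X p ∂(@Measure.map Ω (Ω × ℕ) m (optionalSigma F) (fun ω => (ω, t))
      (ρ.withDensity fun ω => ENNReal.ofReal (γ t ω))) = ∫ ω, γ t ω * X (ω, t) ∂ρ := by
    intro t
    rw [integral_map (hs t).aemeasurable hX.aestronglyMeasurable,
      integral_withDensity_eq_integral_toReal_smul (hγm t).ennreal_ofReal
        (Eventually.of_forall fun _ => ENNReal.ofReal_lt_top)]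
    simp [ENNReal.toReal_ofReal (hγ_nonneg t _)]
  simp_rw [hterm]
  refine (integral_tsum (fun t => ((hγm t).mul (hXt t)).aestronglyMeasurable) ?_).symm
  have hfin := hint.2
  rw [HasFiniteIntegral, lintegral_optionalMeasure ρ hγ hX.enorm] at hfin
  simpa only [Pi.mul_apply, enorm_mul, Real.enorm_of_nonneg (hγ_nonneg _ _)] using hfin.ne

theorem eq_optionalMeasure_of_integral_eq (ρ : Measure Ω) [IsProbabilityMeasure ρ]
    {γ : ℕ → Ω → ℝ} (hγ : ∀ t, Measurable[F t] (γ t)) (hγ_nonneg : ∀ t ω, 0 ≤ γ t ω)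
    (hγ_sum : ∀ᵐ ω ∂ρ, HasSum (fun t => γ t ω) 1)
    (ν : @Measure (Ω × ℕ) (optionalSigma F)) [IsProbabilityMeasure ν]
    (hν : ∀ X : Ω × ℕ → ℝ, Measurable[optionalSigma F] X → (∃ C : ℝ, ∀ p, |X p| ≤ C) →
      ∫ p, X p ∂ν = ∫ ω, ∑' t, X (ω, t) * γ t ω ∂ρ) :
    ν = optionalMeasure F ρ γ := by
  let _ : MeasurableSpace (Ω × ℕ) := optionalSigma F
  have hprob := isProbabilityMeasure_optionalMeasure ρ hγ hγ_nonneg hγ_sum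
  refine Measure.ext fun B hB => ?_
  have hm : Measurable[optionalSigma F] (B.indicator (fun _ => (1 : ℝ))) :=
    (@measurable_const _ _ _ (optionalSigma F) _).indicator hB
  have hb : ∃ C : ℝ, ∀ p, |B.indicator (fun _ => (1 : ℝ)) p| ≤ C :=
    ⟨1, fun p => by by_cases h : p ∈ B <;> simp [h]⟩
  have h := hν _ hm hb
  simp_rw [mul_comm _ (γ _ _)] at h
  rw [← integral_optionalMeasure ρ hγ hγ_nonneg hγ_sum hm hb, integral_indicator_const _ hB,
    integral_indicator_const _ hB] at h
  simpa [measureReal_def, ENNReal.toReal_eq_toReal_iff' (measure_ne_top ν B)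
    (measure_ne_top (optionalMeasure F ρ γ) B)] using h

end OptionalMeasure

theorem lintegral_density_mul_eq_lintegral {Ω : Type*} {m₀ m : MeasurableSpace Ω} (hm : m₀ ≤ m)
    {P Q : Measure Ω} [IsProbabilityMeasure Q] {M : Ω → ℝ}
    (hM : Measurable[m₀] M) (hM_nonneg : ∀ ω, 0 ≤ M ω)
    (hM_dens : ∀ A : Set Ω, MeasurableSet[m₀] A → ∫ ω in A, M ω ∂P = (Q A).toReal)
    {g : Ω → ENNReal} (hg : Measurable[m₀] g) :
    ∫⁻ ω, ENNReal.ofReal (M ω) * g ω ∂P = ∫⁻ ω, g ω ∂Q := by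
  have hint : Integrable M P := by
    by_contra h
    have h1 := hM_dens Set.univ (@MeasurableSet.univ _ m₀)
    rw [setIntegral_univ, integral_undef h] at h1
    simp at h1
  have htrim : (P.withDensity fun ω => ENNReal.ofReal (M ω)).trim hm = Q.trim hm := by
    refine @Measure.ext _ m₀ _ _ fun A hA => ?_
    rw [trim_measurableSet_eq hm hA, trim_measurableSet_eq hm hA, withDensity_apply _ (hm A hA),
      ← ofReal_integral_eq_lintegral_ofReal hint.integrableOn (Eventually.of_forall hM_nonneg),
      hM_dens A hA, ENNReal.ofReal_toReal (measure_ne_top Q A)]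
  rw [← lintegral_trim hm hg, ← htrim, lintegral_trim hm hg,
    lintegral_withDensity_eq_lintegral_mul _ (hM.mono hm le_rfl).ennreal_ofReal
      (hg.mono hm le_rfl)]
  rfl

/-- **From a pair `(Q, γ)` to a measure `Q̄ = Q ⊗ γ ≪ P̄` on the optional σ-field.**
Let `Q` be locally absolutely continuous with respect to `P` with density process `M`,
and let `γ` be a nonnegative adapted process with `∑_t γ_t = 1` `Q`-a.s.  Then
`Z̄(ω,t) := M_t(ω) γ_t(ω) / μ_t(ω)` is a nonnegative `ℱ̄`-measurable function with
`∫ Z̄ dP̄ = 1`, and the measure `Q̄ := Z̄ ⬝ P̄` is a probability measure, absolutely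
continuous with respect to `P̄`, satisfying `∫ X dQ̄ = E_Q[∑_t γ_t X_t]` for all bounded
`ℱ̄`-measurable `X`. -/
theorem stmt_2 {Ω : Type*} {m : MeasurableSpace Ω} (F : Filtration ℕ m)
    (P : Measure Ω) [IsProbabilityMeasure P]
    (hF0 : ∀ A : Set Ω, MeasurableSet[F 0] A → P A = 0 ∨ P A = 1)
    (μ : ℕ → Ω → ℝ)
    (hμ_meas : ∀ t, Measurable[F t] (μ t))
    (hμ_nonneg : ∀ t ω, 0 ≤ μ t ω)
    (hμ_pos : ∀ t, ∀ᵐ ω ∂P, 0 < μ t ω)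
    (hμ_sum : ∀ᵐ ω ∂P, HasSum (fun t => μ t ω) 1)
    (Pbar : @Measure (Ω × ℕ) (optionalSigma F))
    (hPbar_prob : IsProbabilityMeasure Pbar)
    (hPbar : ∀ X : Ω × ℕ → ℝ, Measurable[optionalSigma F] X →
      (∃ C : ℝ, ∀ p, |X p| ≤ C) →
      ∫ p, X p ∂Pbar = ∫ ω, ∑' t, X (ω, t) * μ t ω ∂P)
    (Q : Measure Ω) [IsProbabilityMeasure Q]
    (hQ_loc : ∀ t, ∀ A : Set Ω, MeasurableSet[F t] A → P A = 0 → Q A = 0)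
    (M : ℕ → Ω → ℝ)
    (hM_meas : ∀ t, Measurable[F t] (M t)) (hM_nonneg : ∀ t ω, 0 ≤ M t ω)
    (hM_dens : ∀ t, ∀ A : Set Ω, MeasurableSet[F t] A →
      ∫ ω in A, M t ω ∂P = (Q A).toReal)
    (γ : ℕ → Ω → ℝ)
    (hγ_meas : ∀ t, Measurable[F t] (γ t)) (hγ_nonneg : ∀ t ω, 0 ≤ γ t ω)
    (hγ_sum : ∀ᵐ ω ∂Q, HasSum (fun t => γ t ω) 1) :
    Measurable[optionalSigma F] (fun p : Ω × ℕ => M p.2 p.1 * γ p.2 p.1 / μ p.2 p.1) ∧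
    (∀ p : Ω × ℕ, 0 ≤ M p.2 p.1 * γ p.2 p.1 / μ p.2 p.1) ∧
    (∫ p, M p.2 p.1 * γ p.2 p.1 / μ p.2 p.1 ∂Pbar = 1) ∧
    (Pbar.withDensity (fun p : Ω × ℕ => ENNReal.ofReal (M p.2 p.1 * γ p.2 p.1 / μ p.2 p.1))
        ≪ Pbar) ∧
    IsProbabilityMeasure
      (Pbar.withDensity (fun p : Ω × ℕ => ENNReal.ofReal (M p.2 p.1 * γ p.2 p.1 / μ p.2 p.1))) ∧
    (∀ X : Ω × ℕ → ℝ, Measurable[optionalSigma F] X → (∃ C : ℝ, ∀ p, |X p| ≤ C) →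
      ∫ p, X p
          ∂(Pbar.withDensity
            (fun p : Ω × ℕ => ENNReal.ofReal (M p.2 p.1 * γ p.2 p.1 / μ p.2 p.1))) =
        ∫ ω, ∑' t, γ t ω * X (ω, t) ∂Q) := by
  let _ : MeasurableSpace (Ω × ℕ) := optionalSigma F
  have hZ : Measurable[optionalSigma F]
      (fun p : Ω × ℕ => M p.2 p.1 * γ p.2 p.1 / μ p.2 p.1) :=
    measurable_optionalSigma_of_sections F fun t =>
      ((hM_meas t).mul (hγ_meas t)).div (hμ_meas t)
  have hZ_nonneg : ∀ p : Ω × ℕ, 0 ≤ M p.2 p.1 * γ p.2 p.1 / μ p.2 p.1 := fun p =>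
    div_nonneg (mul_nonneg (hM_nonneg _ _) (hγ_nonneg _ _)) (hμ_nonneg _ _)
  have hPbar_eq := eq_optionalMeasure_of_integral_eq P hμ_meas hμ_nonneg hμ_sum Pbar hPbar
  have hQbar : Pbar.withDensity
      (fun p : Ω × ℕ => ENNReal.ofReal (M p.2 p.1 * γ p.2 p.1 / μ p.2 p.1)) =
      optionalMeasure F Q γ := by
    refine Measure.ext fun B hB => ?_
    have hI : Measurable[optionalSigma F] (B.indicator (fun _ => (1 : ENNReal))) :=
      (@measurable_const _ _ _ (optionalSigma F) _).indicator hB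
    rw [← lintegral_indicator_one hB, ← lintegral_indicator_one hB]
    change ∫⁻ p, B.indicator (fun _ => (1 : ENNReal)) p ∂_ =
      ∫⁻ p, B.indicator (fun _ => (1 : ENNReal)) p ∂_
    rw [lintegral_withDensity_eq_lintegral_mul _ hZ.ennreal_ofReal hI, hPbar_eq,
      lintegral_optionalMeasure P hμ_meas (hZ.ennreal_ofReal.mul hI),
      lintegral_optionalMeasure Q hγ_meas hI]
    congr with t
    refine (lintegral_congr_ae ?_).trans (lintegral_density_mul_eq_lintegral (P := P) (F.le t)
      (hM_meas t) (hM_nonneg t) (hM_dens t) ((hγ_meas t).ennreal_ofReal.mul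
        (hI.comp (measurable_section_optionalSigma F t))))
    filter_upwards [hμ_pos t] with ω hω
    simp only [Pi.mul_apply]
    rw [← mul_assoc, ← mul_assoc, ← ENNReal.ofReal_mul (hμ_nonneg t ω),
      ← ENNReal.ofReal_mul (hM_nonneg t ω), mul_div_cancel₀ _ hω.ne']
  have hprob := isProbabilityMeasure_optionalMeasure Q hγ_meas hγ_nonneg hγ_sum
  refine ⟨hZ, hZ_nonneg, ?_, withDensity_absolutelyContinuous _ _, hQbar ▸ hprob, ?_⟩
  · rw [integral_eq_lintegral_of_nonneg_ae (Eventually.of_forall hZ_nonneg)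
      hZ.aestronglyMeasurable, ← setLIntegral_univ,
      ← withDensity_apply _ (@MeasurableSet.univ _ (optionalSigma F)), hQbar, measure_univ,
      ENNReal.toReal_one]
  · intro X hX hX_bdd
    rw [hQbar]
    exact integral_optionalMeasure Q hγ_meas hγ_nonneg hγ_sum hX hX_bdd
end

section
/- Let Q̄ = Q ⊗ γ be a probability measure on (Ω̄, ℱ̄) as in the context. Then for every t ∈ ℕ, Q̄ agrees with P̄ on the optional σ-field ℱ̄_t (i.e. Q̄(B) = P̄(B) for all B ∈ ℱ̄_t) if and only if Q(A) = P(A) for all A ∈ ℱ_t and γ_s = μ_s P-a.s. for every s < t. -/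
open MeasureTheory Filter

/-- The optional filtration `ℱ̄_t` on `Ω̄ = Ω × ℕ`. -/
def optionalFiltration {Ω : Type*} {m : MeasurableSpace Ω} (F : Filtration ℕ m) (t : ℕ) :
    MeasurableSpace (Ω × ℕ) :=
  MeasurableSpace.generateFrom
    ({B | ∃ (j : ℕ) (A : Set Ω), j < t ∧ MeasurableSet[F j] A ∧ B = A ×ˢ ({j} : Set ℕ)} ∪
      {B | ∃ A : Set Ω, MeasurableSet[F t] A ∧ B = A ×ˢ {s : ℕ | t ≤ s}})

section OptionalSigma

variable {Ω : Type*} {m' m : MeasurableSpace Ω}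

/-- An integral of a function measurable for a sub-σ-algebra only sees the measure there. -/
lemma setLIntegral_eq_of_eq_on (hm : m' ≤ m) {P Q : Measure Ω}
    (h : ∀ A, MeasurableSet[m'] A → Q A = P A) {f : Ω → ENNReal} (hf : Measurable[m'] f)
    {A : Set Ω} (hA : MeasurableSet[m'] A) : ∫⁻ ω in A, f ω ∂Q = ∫⁻ ω in A, f ω ∂P := by
  have htrim : Q.trim hm = P.trim hm := by
    refine @Measure.ext _ m' _ _ fun B hB => ?_
    rw [trim_measurableSet_eq hm hB, trim_measurableSet_eq hm hB, h B hB]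
  rw [← lintegral_trim hm hf, ← lintegral_trim hm hf, ← restrict_trim hm _ hA,
    ← restrict_trim hm _ hA, htrim]

/-- Functions measurable for a sub-σ-algebra with the same integrals there agree a.e. -/
lemma ae_eq_of_setLIntegral_eq_on (hm : m' ≤ m) {P : Measure Ω}
    [IsFiniteMeasure P] {f g : Ω → ENNReal} (hf : Measurable[m'] f) (hg : Measurable[m'] g)
    (h : ∀ A, MeasurableSet[m'] A → ∫⁻ ω in A, f ω ∂P = ∫⁻ ω in A, g ω ∂P) : f =ᵐ[P] g := by
  refine ae_eq_of_ae_eq_trim (hm := hm) ?_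
  refine ae_eq_of_forall_setLIntegral_eq_of_sigmaFinite hf hg fun A hA _ => ?_
  rw [restrict_trim hm _ hA, lintegral_trim hm hf, lintegral_trim hm hg, h A hA]

/-- Two measures with the same positive finite density multiple on a sub-σ-algebra agree there. -/
lemma eq_on_of_setLIntegral_eq (hm : m' ≤ m) {P Q : Measure Ω}
    {f : Ω → ENNReal} (hf : Measurable[m'] f) (hP : ∀ᵐ ω ∂P, f ω ≠ 0) (hQ : ∀ᵐ ω ∂Q, f ω ≠ 0)
    (hfin : ∀ ω, f ω ≠ ⊤)
    (h : ∀ A, MeasurableSet[m'] A → ∫⁻ ω in A, f ω ∂Q = ∫⁻ ω in A, f ω ∂P)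
    {A : Set Ω} (hA : MeasurableSet[m'] A) : Q A = P A := by
  have hne : MeasurableSet[m'] {ω | f ω ≠ 0} := (hf (measurableSet_singleton 0)).compl
  have hwd : (Q.trim hm).withDensity f = (P.trim hm).withDensity f := by
    refine @Measure.ext _ m' _ _ fun B hB => ?_
    rw [withDensity_apply _ hB, withDensity_apply _ hB, restrict_trim hm _ hB,
      restrict_trim hm _ hB, lintegral_trim hm hf, lintegral_trim hm hf, h B hB]
  have ht : ∀ ν : Measure Ω, (∀ᵐ ω ∂ν, f ω ≠ 0) → ∀ᵐ ω ∂(ν.trim hm), f ω ≠ 0 := by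
    intro ν hν
    exact (trim_measurableSet_eq hm hne.compl).trans hν
  rw [← trim_measurableSet_eq hm hA, ← trim_measurableSet_eq hm hA,
    ← withDensity_inv_same hf (ht Q hQ) (ae_of_all _ hfin), hwd,
    withDensity_inv_same hf (ht P hP) (ae_of_all _ hfin)]

variable (F : Filtration ℕ m)

lemma measurableSet_optionalFiltration_prod_singleton {j t : ℕ} (hj : j < t) {A : Set Ω}
    (hA : MeasurableSet[F j] A) : MeasurableSet[optionalFiltration F t] (A ×ˢ ({j} : Set ℕ)) :=
  MeasurableSpace.measurableSet_generateFrom (Or.inl ⟨j, A, hj, hA, rfl⟩)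

lemma measurableSet_optionalFiltration_prod_tail {s t : ℕ} (hs : s ≤ t) {A : Set Ω}
    (hA : MeasurableSet[F s] A) : MeasurableSet[optionalFiltration F t] (A ×ˢ {r : ℕ | s ≤ r}) := by
  have h : A ×ˢ {r : ℕ | s ≤ r} =
      (⋃ j ∈ Set.Ico s t, A ×ˢ ({j} : Set ℕ)) ∪ A ×ˢ {r : ℕ | t ≤ r} := by
    ext ⟨ω, n⟩
    simp only [Set.mem_prod, Set.mem_ofPred_eq, Set.mem_union, Set.mem_iUnion, Set.mem_Ico,
      Set.mem_singleton_iff, exists_prop]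
    constructor
    · rintro ⟨h1, h2⟩
      rcases lt_or_ge n t with h3 | h3
      · exact Or.inl ⟨n, ⟨h2, h3⟩, h1, rfl⟩
      · exact Or.inr ⟨h1, h3⟩
    · rintro (⟨j, ⟨h1, h2⟩, h3, rfl⟩ | ⟨h1, h2⟩)
      · exact ⟨h3, h1⟩
      · exact ⟨h1, hs.trans h2⟩
  rw [h]
  refine MeasurableSet.union (MeasurableSet.biUnion (Set.to_countable _) fun j hj => ?_) ?_
  · exact measurableSet_optionalFiltration_prod_singleton F hj.2 (F.mono hj.1 _ hA)
  · exact MeasurableSpace.measurableSet_generateFrom (Or.inr ⟨A, F.mono hs _ hA, rfl⟩)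

lemma measurableSet_optionalSigma_prod_singleton {j : ℕ} {A : Set Ω}
    (hA : MeasurableSet[F j] A) : MeasurableSet[optionalSigma F] (A ×ˢ ({j} : Set ℕ)) :=
  MeasurableSpace.measurableSet_generateFrom ⟨j, A, hA, rfl⟩

lemma measurableSet_optionalSigma_prod_tail {s : ℕ} {A : Set Ω}
    (hA : MeasurableSet[F s] A) : MeasurableSet[optionalSigma F] (A ×ˢ {r : ℕ | s ≤ r}) := by
  have h : A ×ˢ {r : ℕ | s ≤ r} = ⋃ j ∈ Set.Ici s, A ×ˢ ({j} : Set ℕ) := by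
    ext ⟨ω, n⟩
    simp [and_comm]
  rw [h]
  exact MeasurableSet.biUnion (Set.to_countable _) fun j hj =>
    measurableSet_optionalSigma_prod_singleton F (F.mono hj _ hA)

lemma optionalFiltration_le (t : ℕ) : optionalFiltration F t ≤ optionalSigma F := by
  refine MeasurableSpace.generateFrom_le ?_
  rintro B (⟨j, A, -, hA, rfl⟩ | ⟨A, hA, rfl⟩)
  · exact measurableSet_optionalSigma_prod_singleton F hA
  · exact measurableSet_optionalSigma_prod_tail F hA

lemma isPiSystem_optionalFiltration (t : ℕ) : IsPiSystem
    ({B | ∃ (j : ℕ) (A : Set Ω), j < t ∧ MeasurableSet[F j] A ∧ B = A ×ˢ ({j} : Set ℕ)} ∪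
      {B | ∃ A : Set Ω, MeasurableSet[F t] A ∧ B = A ×ˢ {s : ℕ | t ≤ s}}) := by
  rintro _ (⟨j, A, hj, hA, rfl⟩ | ⟨A, hA, rfl⟩) _ (⟨k, B, hk, hB, rfl⟩ | ⟨B, hB, rfl⟩) ⟨⟨ω, n⟩, h⟩
  · obtain ⟨⟨-, h1⟩, ⟨-, h2⟩⟩ := h
    obtain rfl : n = j := h1
    obtain rfl : n = k := h2
    exact Or.inl ⟨n, A ∩ B, hj, hA.inter hB, by rw [Set.prod_inter_prod, Set.inter_self]⟩
  · obtain ⟨⟨-, h1⟩, ⟨-, h2⟩⟩ := h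
    obtain rfl : n = j := h1
    exact absurd h2 (not_le.2 hj)
  · obtain ⟨⟨-, h1⟩, ⟨-, h2⟩⟩ := h
    obtain rfl : n = k := h2
    exact absurd h1 (not_le.2 hk)
  · exact Or.inr ⟨A ∩ B, hA.inter hB, by rw [Set.prod_inter_prod, Set.inter_self]⟩

variable {F} {ν : Measure Ω} [IsFiniteMeasure ν] {w : ℕ → Ω → ℝ}
  {νbar : @Measure (Ω × ℕ) (optionalSigma F)}

/-- The measure `ν ⊗ w` of a product set. -/
lemma optional_apply_prod (hw_nonneg : ∀ᵐ ω ∂ν, ∀ s, 0 ≤ w s ω)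
    (hw_sum : ∀ᵐ ω ∂ν, HasSum (fun s => w s ω) 1) (hfin : IsFiniteMeasure νbar)
    (hνbar : ∀ X : Ω × ℕ → ℝ, Measurable[optionalSigma F] X → (∃ C : ℝ, ∀ p, |X p| ≤ C) →
      ∫ p, X p ∂νbar = ∫ ω, ∑' s, w s ω * X (ω, s) ∂ν)
    {S : Set ℕ} {A : Set Ω} (hA : MeasurableSet A)
    (hAS : MeasurableSet[optionalSigma F] (A ×ˢ S)) {f : Ω → ℝ} (hf : Measurable f)
    (hfS : ∀ᵐ ω ∂ν, HasSum (S.indicator fun s => w s ω) (f ω)) :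
    νbar (A ×ˢ S) = ∫⁻ ω in A, ENNReal.ofReal (f ω) ∂ν := by
  have h0 : ∀ᵐ ω ∂ν, 0 ≤ f ω := by
    filter_upwards [hw_nonneg, hfS] with ω h1 h2
    exact h2.nonneg fun s => Set.indicator_nonneg (fun s _ => h1 s) s
  have h1 : ∀ᵐ ω ∂ν, f ω ≤ 1 := by
    filter_upwards [hw_nonneg, hfS, hw_sum] with ω h1 h2 h3
    exact hasSum_le (fun s => Set.indicator_le_self' (fun _ _ => h1 s) s) h2 h3
  have hint : Integrable f ν := by
    refine Integrable.of_bound hf.aestronglyMeasurable 1 ?_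
    filter_upwards [h0, h1] with ω h2 h3
    rwa [Real.norm_of_nonneg h2]
  have key := hνbar ((A ×ˢ S).indicator 1) (measurable_const.indicator hAS)
    ⟨1, fun p => by by_cases hp : p ∈ A ×ˢ S <;> simp [hp]⟩
  rw [integral_indicator_one hAS] at key
  have hcongr : ∫ ω, ∑' s, w s ω * (A ×ˢ S).indicator (1 : Ω × ℕ → ℝ) (ω, s) ∂ν =
      ∫ ω in A, f ω ∂ν := by
    rw [← integral_indicator hA]
    refine integral_congr_ae ?_
    filter_upwards [hfS] with ω hω
    by_cases hωA : ω ∈ A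
    · rw [Set.indicator_of_mem hωA, ← hω.tsum_eq]
      refine tsum_congr fun s => ?_
      by_cases hs : s ∈ S <;> simp [hs, hωA]
    · simp [hωA]
  rw [hcongr] at key
  rw [← ofReal_integral_eq_lintegral_ofReal hint.integrableOn (ae_restrict_of_ae h0), ← key,
    ofReal_measureReal]

lemma optional_apply_prod_singleton (hw_meas : ∀ s, Measurable[F s] (w s))
    (hw_nonneg : ∀ᵐ ω ∂ν, ∀ s, 0 ≤ w s ω)
    (hw_sum : ∀ᵐ ω ∂ν, HasSum (fun s => w s ω) 1) (hfin : IsFiniteMeasure νbar)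
    (hνbar : ∀ X : Ω × ℕ → ℝ, Measurable[optionalSigma F] X → (∃ C : ℝ, ∀ p, |X p| ≤ C) →
      ∫ p, X p ∂νbar = ∫ ω, ∑' s, w s ω * X (ω, s) ∂ν)
    {j : ℕ} {A : Set Ω} (hA : MeasurableSet[F j] A) :
    νbar (A ×ˢ ({j} : Set ℕ)) = ∫⁻ ω in A, ENNReal.ofReal (w j ω) ∂ν := by
  refine optional_apply_prod hw_nonneg hw_sum hfin hνbar (F.le j _ hA)
    (measurableSet_optionalSigma_prod_singleton F hA) ((hw_meas j).mono (F.le j) le_rfl)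
    (ae_of_all _ fun ω => ?_)
  convert hasSum_single (f := Set.indicator {j} fun s => w s ω) j
    (fun s hs => Set.indicator_of_notMem (Set.notMem_singleton_iff.2 hs) _) using 1
  simp

lemma measurable_one_sub_sum (hw_meas : ∀ s, Measurable[F s] (w s)) {t u : ℕ} (htu : t ≤ u + 1) :
    Measurable[F u] fun ω => 1 - ∑ r ∈ Finset.range t, w r ω := by
  refine Measurable.sub measurable_const (Finset.measurable_sum _ fun r hr => ?_)
  have : r < t := Finset.mem_range.1 hr
  exact (hw_meas r).mono (F.mono (by omega)) le_rfl

lemma optional_apply_prod_tail (hw_meas : ∀ s, Measurable[F s] (w s))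
    (hw_nonneg : ∀ᵐ ω ∂ν, ∀ s, 0 ≤ w s ω)
    (hw_sum : ∀ᵐ ω ∂ν, HasSum (fun s => w s ω) 1) (hfin : IsFiniteMeasure νbar)
    (hνbar : ∀ X : Ω × ℕ → ℝ, Measurable[optionalSigma F] X → (∃ C : ℝ, ∀ p, |X p| ≤ C) →
      ∫ p, X p ∂νbar = ∫ ω, ∑' s, w s ω * X (ω, s) ∂ν)
    {t : ℕ} {A : Set Ω} (hA : MeasurableSet[F t] A) :
    νbar (A ×ˢ {s : ℕ | t ≤ s}) =
      ∫⁻ ω in A, ENNReal.ofReal (1 - ∑ r ∈ Finset.range t, w r ω) ∂ν := by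
  refine optional_apply_prod hw_nonneg hw_sum hfin hνbar (F.le t _ hA)
    (measurableSet_optionalSigma_prod_tail F hA)
    ((measurable_one_sub_sum hw_meas (Nat.le_succ t)).mono (F.le t) le_rfl) ?_
  filter_upwards [hw_sum] with ω hω
  have hpartial : HasSum (Set.indicator (Finset.range t : Set ℕ) fun s => w s ω)
      (∑ r ∈ Finset.range t, w r ω) := by
    rw [← hasSum_subtype_iff_indicator]
    exact (Finset.range t).hasSum fun s => w s ω
  have heq : ({s : ℕ | t ≤ s}.indicator fun s => w s ω) =
      fun s => w s ω - (Finset.range t : Set ℕ).indicator (fun s => w s ω) s := by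
    ext s
    by_cases hs : t ≤ s
    · simp [Set.indicator, hs, not_lt.2 hs]
    · simp [Set.indicator, hs, not_le.1 hs]
  rw [heq]
  exact hω.sub hpartial

lemma one_sub_sum_range_pos {a : ℕ → ℝ} (ha : ∀ s, 0 < a s) (hsum : HasSum a 1) (t : ℕ) :
    0 < 1 - ∑ r ∈ Finset.range t, a r := by
  have h := hsum.summable.sum_le_tsum (Finset.range (t + 1)) fun s _ => (ha s).le
  rw [hsum.tsum_eq, Finset.sum_range_succ] at h
  linarith [ha t]

end OptionalSigma

/-- **Agreement of `Q̄ = Q ⊗ γ` with `P̄ = P ⊗ μ` on the optional filtration.**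
`Q̄ = P̄` on `ℱ̄_t` if and only if `Q = P` on `ℱ_t` and `γ_s = μ_s` `P`-a.s. for every
`s < t`. -/
theorem stmt_6 {Ω : Type*} {m : MeasurableSpace Ω} (F : Filtration ℕ m)
    (P : Measure Ω) [IsProbabilityMeasure P]
    (hF0 : ∀ A : Set Ω, MeasurableSet[F 0] A → P A = 0 ∨ P A = 1)
    (μ : ℕ → Ω → ℝ)
    (hμ_meas : ∀ s, Measurable[F s] (μ s))
    (hμ_pos : ∀ s, ∀ᵐ ω ∂P, 0 < μ s ω)
    (hμ_sum : ∀ᵐ ω ∂P, HasSum (fun s => μ s ω) 1)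
    (Pbar : @Measure (Ω × ℕ) (optionalSigma F))
    (hPbar_prob : IsProbabilityMeasure Pbar)
    (hPbar : ∀ X : Ω × ℕ → ℝ, Measurable[optionalSigma F] X →
      (∃ C : ℝ, ∀ p, |X p| ≤ C) →
      ∫ p, X p ∂Pbar = ∫ ω, ∑' s, X (ω, s) * μ s ω ∂P)
    (Q : Measure Ω) [IsProbabilityMeasure Q]
    (hQ_loc : ∀ s, ∀ A : Set Ω, MeasurableSet[F s] A → P A = 0 → Q A = 0)
    (γ : ℕ → Ω → ℝ)
    (hγ_meas : ∀ s, Measurable[F s] (γ s)) (hγ_nonneg : ∀ s ω, 0 ≤ γ s ω)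
    (hγ_sum : ∀ᵐ ω ∂Q, HasSum (fun s => γ s ω) 1)
    (Qbar : @Measure (Ω × ℕ) (optionalSigma F))
    (hQbar_prob : IsProbabilityMeasure Qbar)
    (hQbar : ∀ X : Ω × ℕ → ℝ, Measurable[optionalSigma F] X →
      (∃ C : ℝ, ∀ p, |X p| ≤ C) →
      ∫ p, X p ∂Qbar = ∫ ω, ∑' s, γ s ω * X (ω, s) ∂Q)
    (t : ℕ) :
    (∀ B : Set (Ω × ℕ), MeasurableSet[optionalFiltration F t] B → Qbar B = Pbar B) ↔
      ((∀ A : Set Ω, MeasurableSet[F t] A → Q A = P A) ∧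
        ∀ s < t, γ s =ᵐ[P] μ s) := by
  have hPbar' : ∀ X : Ω × ℕ → ℝ, Measurable[optionalSigma F] X → (∃ C : ℝ, ∀ p, |X p| ≤ C) →
      ∫ p, X p ∂Pbar = ∫ ω, ∑' s, μ s ω * X (ω, s) ∂P := by
    intro X hX hC
    simp_rw [hPbar X hX hC, mul_comm]
  have hμ_pos' : ∀ᵐ ω ∂P, ∀ s, 0 < μ s ω := ae_all_iff.2 hμ_pos
  have hμ_nonneg : ∀ᵐ ω ∂P, ∀ s, 0 ≤ μ s ω := hμ_pos'.mono fun ω h s => (h s).le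
  have hγ_nonneg' : ∀ᵐ ω ∂Q, ∀ s, 0 ≤ γ s ω := ae_of_all _ fun ω s => hγ_nonneg s ω
  have hPbar_fin : IsFiniteMeasure Pbar := inferInstance
  have hQbar_fin : IsFiniteMeasure Qbar := inferInstance
  have hPs := fun j A hA => optional_apply_prod_singleton (j := j) (A := A)
    hμ_meas hμ_nonneg hμ_sum hPbar_fin hPbar' hA
  have hQs := fun j A hA => optional_apply_prod_singleton (j := j) (A := A)
    hγ_meas hγ_nonneg' hγ_sum hQbar_fin hQbar hA
  have hPt := fun j A hA => optional_apply_prod_tail (t := j) (A := A)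
    hμ_meas hμ_nonneg hμ_sum hPbar_fin hPbar' hA
  have hQt := fun j A hA => optional_apply_prod_tail (t := j) (A := A)
    hγ_meas hγ_nonneg' hγ_sum hQbar_fin hQbar hA
  have hsum_congr : ∀ s, (∀ r < s, γ r =ᵐ[P] μ r) →
      ∀ᵐ ω ∂P, ∑ r ∈ Finset.range s, γ r ω = ∑ r ∈ Finset.range s, μ r ω := by
    intro s hs
    have : ∀ᵐ ω ∂P, ∀ r, r < s → γ r ω = μ r ω :=
      ae_all_iff.2 fun r => by
        by_cases hr : r < s
        · filter_upwards [hs r hr] with ω h _ using h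
        · exact ae_of_all _ fun ω h => absurd h hr
    filter_upwards [this] with ω h
    exact Finset.sum_congr rfl fun r hr => h r (Finset.mem_range.1 hr)
  constructor
  · intro h
    have hpoint : ∀ j < t, ∀ A, MeasurableSet[F j] A →
        ∫⁻ ω in A, ENNReal.ofReal (γ j ω) ∂Q = ∫⁻ ω in A, ENNReal.ofReal (μ j ω) ∂P := by
      intro j hj A hA
      rw [← hPs j A hA, ← hQs j A hA]
      exact h _ (measurableSet_optionalFiltration_prod_singleton F hj hA)
    have htail : ∀ s ≤ t, ∀ A, MeasurableSet[F s] A →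
        ∫⁻ ω in A, ENNReal.ofReal (1 - ∑ r ∈ Finset.range s, γ r ω) ∂Q =
          ∫⁻ ω in A, ENNReal.ofReal (1 - ∑ r ∈ Finset.range s, μ r ω) ∂P := by
      intro s hs A hA
      rw [← hPt s A hA, ← hQt s A hA]
      exact h _ (measurableSet_optionalFiltration_prod_tail F hs hA)
    suffices H : ∀ s ≤ t, (∀ A : Set Ω, MeasurableSet[F s] A → Q A = P A) ∧
        ∀ r < s, γ r =ᵐ[P] μ r from H t le_rfl
    intro s
    induction s with
    | zero =>
      refine fun _ => ⟨fun A hA => ?_, fun r hr => absurd hr (Nat.not_lt_zero r)⟩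
      rcases hF0 A hA with h0 | h1
      · rw [h0, hQ_loc 0 A hA h0]
      · have hc := hQ_loc 0 Aᶜ hA.compl ((prob_compl_eq_zero_iff (F.le 0 _ hA)).2 h1)
        rw [h1, (prob_compl_eq_zero_iff (F.le 0 _ hA)).1 hc]
    | succ s ih =>
      intro hs
      obtain ⟨hQP, hγμ⟩ := ih (by omega)
      have hγμ' : ∀ r < s + 1, γ r =ᵐ[P] μ r := by
        intro r hr
        rcases Nat.lt_succ_iff_lt_or_eq.1 hr with hr | rfl
        · exact hγμ r hr
        have hγr := ENNReal.measurable_ofReal.comp (hγ_meas r)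
        have hae := ae_eq_of_setLIntegral_eq_on (P := P) (F.le r) hγr
          (ENNReal.measurable_ofReal.comp (hμ_meas r)) fun A hA => by
            rw [← setLIntegral_eq_of_eq_on (F.le r) hQP hγr hA]
            exact hpoint r hs A hA
        filter_upwards [hae, hμ_nonneg] with ω h1 h2
        exact (ENNReal.ofReal_eq_ofReal_iff (hγ_nonneg r ω) (h2 r)).1 h1
      refine ⟨fun A hA => ?_, hγμ'⟩
      have hmeas := measurable_one_sub_sum (F := F) hγ_meas (Nat.le_succ (s + 1))
      have hpos : ∀ᵐ ω ∂P, 0 < 1 - ∑ r ∈ Finset.range (s + 1), γ r ω := by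
        filter_upwards [hsum_congr _ hγμ', hμ_pos', hμ_sum] with ω h1 h2 h3
        rw [h1]
        exact one_sub_sum_range_pos h2 h3 _
      have hposQ : ∀ᵐ ω ∂Q, 0 < 1 - ∑ r ∈ Finset.range (s + 1), γ r ω :=
        hQ_loc (s + 1) _ (hmeas measurableSet_Ioi).compl hpos
      refine eq_on_of_setLIntegral_eq (F.le (s + 1)) (ENNReal.measurable_ofReal.comp hmeas)
        (hpos.mono fun ω h => (ENNReal.ofReal_pos.2 h).ne')
        (hposQ.mono fun ω h => (ENNReal.ofReal_pos.2 h).ne')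
        (fun ω => ENNReal.ofReal_ne_top) (fun B hB => ?_) hA
      refine (htail (s + 1) hs B hB).trans (lintegral_congr_ae (ae_restrict_of_ae ?_))
      filter_upwards [hsum_congr _ hγμ'] with ω h1
      simp only [Function.comp_apply, h1]
  · rintro ⟨hQP, hγμ⟩ B hB
    refine ext_on_measurableSpace_of_generate_finite (optionalSigma F) _ ?_
      (optionalFiltration_le F t) rfl (isPiSystem_optionalFiltration F t) ?_ hB
    · rintro _ (⟨j, A, hj, hA, rfl⟩ | ⟨A, hA, rfl⟩)
      · rw [hQs j A hA, hPs j A hA]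
        refine (setLIntegral_eq_of_eq_on (F.le t) hQP
          (ENNReal.measurable_ofReal.comp ((hγ_meas j).mono (F.mono hj.le) le_rfl))
          (F.mono hj.le _ hA)).trans (lintegral_congr_ae (ae_restrict_of_ae ?_))
        filter_upwards [hγμ j hj] with ω h1
        simp only [Function.comp_apply, h1]
      · rw [hQt t A hA, hPt t A hA]
        refine (setLIntegral_eq_of_eq_on (F.le t) hQP
          (ENNReal.measurable_ofReal.comp (measurable_one_sub_sum hγ_meas (Nat.le_succ t)))
          hA).trans (lintegral_congr_ae (ae_restrict_of_ae ?_))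
        filter_upwards [hsum_congr t hγμ] with ω h1
        simp only [Function.comp_apply, h1]
    · rw [hQbar_prob.measure_univ, hPbar_prob.measure_univ]
end

section
/- Let (ρ_t)_{t∈ℕ} be a dynamic convex risk measure for processes. Then (ρ_t) is time consistent if and only if it is recursive, i.e. for every t ∈ ℕ and every X ∈ ℛ^∞, ρ_t(X) = ρ_t(X_t·1_{{t}} − ρ_{t+1}(X)·1_{𝕋_{t+1}}) P-a.s., where X_t·1_{{t}} − ρ_{t+1}(X)·1_{𝕋_{t+1}} denotes the process equal to 0 at times s < t, to X_t at time t, and to −ρ_{t+1}(X) at all times s ≥ t+1. -/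
open MeasureTheory Filter

variable {Ω : Type*}

/-- Bounded measurable real-valued functions with respect to a σ-algebra (the space `L^∞`). -/
def BddMeas {α : Type*} (mm : MeasurableSpace α) (f : α → ℝ) : Prop :=
  Measurable[mm] f ∧ ∃ C : ℝ, ∀ x, |f x| ≤ C

/-- The space `ℛ^∞` of bounded adapted processes. -/
def MemRinf {m : MeasurableSpace Ω} (F : Filtration ℕ m) (X : ℕ → Ω → ℝ) : Prop :=
  (∀ s, Measurable[F s] (X s)) ∧ ∃ C : ℝ, ∀ s ω, |X s ω| ≤ C

/-- The projection `π_t` killing a process strictly before time `t`. -/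
def projt (t : ℕ) (X : ℕ → Ω → ℝ) : ℕ → Ω → ℝ := fun r ω => if t ≤ r then X r ω else 0

/-- Membership in `ℛ_t^∞ = π_t(ℛ^∞)`: bounded adapted processes vanishing before `t`. -/
def MemRt {m : MeasurableSpace Ω} (F : Filtration ℕ m) (t : ℕ) (X : ℕ → Ω → ℝ) : Prop :=
  MemRinf F X ∧ ∀ r < t, ∀ ω, X r ω = 0

/-- A conditional convex risk measure for processes at time `t`:  a map
`ρ_t : ℛ_t^∞ → L^∞_t` which is conditionally cash invariant, monotone, conditionally
convex and normalized. -/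
structure IsCondRiskMeasure {m : MeasurableSpace Ω} (F : Filtration ℕ m) (P : Measure Ω)
    (t : ℕ) (ρ : (ℕ → Ω → ℝ) → Ω → ℝ) : Prop where
  map_into : ∀ X, MemRt F t X → BddMeas (F t) (ρ X)
  cash : ∀ X, MemRt F t X → ∀ mf : Ω → ℝ, BddMeas (F t) mf →
    ρ (fun r ω => X r ω + if t ≤ r then mf ω else 0) =ᵐ[P] fun ω => ρ X ω - mf ω
  mono : ∀ X Y, MemRt F t X → MemRt F t Y → (∀ s, ∀ᵐ ω ∂P, X s ω ≤ Y s ω) →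
    ∀ᵐ ω ∂P, ρ Y ω ≤ ρ X ω
  convex : ∀ X Y, MemRt F t X → MemRt F t Y → ∀ lam : Ω → ℝ,
    Measurable[F t] lam → (∀ ω, 0 ≤ lam ω ∧ lam ω ≤ 1) →
    ∀ᵐ ω ∂P, ρ (fun r ω => lam ω * X r ω + (1 - lam ω) * Y r ω) ω ≤
      lam ω * ρ X ω + (1 - lam ω) * ρ Y ω
  norm : ρ (fun _ _ => 0) =ᵐ[P] (0 : Ω → ℝ)

/-- Time consistency of a dynamic convex risk measure for processes. -/
def TimeConsistent {m : MeasurableSpace Ω} (F : Filtration ℕ m) (P : Measure Ω)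
    (ρ : ℕ → (ℕ → Ω → ℝ) → Ω → ℝ) : Prop :=
  ∀ t (X Y : ℕ → Ω → ℝ), MemRinf F X → MemRinf F Y →
    X t =ᵐ[P] Y t →
    (∀ᵐ ω ∂P, ρ (t + 1) (projt (t + 1) X) ω ≤ ρ (t + 1) (projt (t + 1) Y) ω) →
    ∀ᵐ ω ∂P, ρ t (projt t X) ω ≤ ρ t (projt t Y) ω

/-- The process `X_t·1_{{t}} − ρ_{t+1}(X)·1_{𝕋_{t+1}}`. -/
def oneStepTarget (ρ : ℕ → (ℕ → Ω → ℝ) → Ω → ℝ) (t : ℕ) (X : ℕ → Ω → ℝ) :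
    ℕ → Ω → ℝ :=
  fun r ω => if r = t then X t ω else if t + 1 ≤ r then -ρ (t + 1) (projt (t + 1) X) ω else 0

/-- The acceptance set `𝒜_t` of a conditional convex risk measure for processes. -/
def AcceptSet {m : MeasurableSpace Ω} (F : Filtration ℕ m) (P : Measure Ω) (t : ℕ)
    (ρ : (ℕ → Ω → ℝ) → Ω → ℝ) : Set (ℕ → Ω → ℝ) :=
  {X | MemRt F t X ∧ ∀ᵐ ω ∂P, ρ X ω ≤ 0}

/-- The one-step acceptance set `𝒜_{t,t+1}`: acceptable processes in `ℛ_{t,t+1}^∞`. -/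
def AcceptSetStep {m : MeasurableSpace Ω} (F : Filtration ℕ m) (P : Measure Ω) (t : ℕ)
    (ρ : (ℕ → Ω → ℝ) → Ω → ℝ) : Set (ℕ → Ω → ℝ) :=
  {X | MemRt F t X ∧ (∀ r, t + 1 ≤ r → X r = X (t + 1)) ∧ ∀ᵐ ω ∂P, ρ X ω ≤ 0}

lemma memRt_projt {m : MeasurableSpace Ω} {F : Filtration ℕ m} {X : ℕ → Ω → ℝ}
    (hX : MemRinf F X) (t : ℕ) : MemRt F t (projt t X) := by
  obtain ⟨hmeas, C, hC⟩ := hX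
  refine ⟨⟨fun s => ?_, C, fun s ω => ?_⟩, fun r hr ω => if_neg (not_le.mpr hr)⟩
  · by_cases h : t ≤ s
    · simpa +unfoldPartialApp [projt, h] using hmeas s
    · simp +unfoldPartialApp [projt, h]
  · by_cases h : t ≤ s
    · simpa [projt, h] using hC s ω
    · simpa [projt, h] using (abs_nonneg _).trans (hC s ω)

lemma memRt_oneStepTarget {m : MeasurableSpace Ω} {F : Filtration ℕ m} {P : Measure Ω}
    {ρ : ℕ → (ℕ → Ω → ℝ) → Ω → ℝ} {t : ℕ} (hρ : IsCondRiskMeasure F P (t + 1) (ρ (t + 1)))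
    {X : ℕ → Ω → ℝ} (hX : MemRinf F X) : MemRt F t (oneStepTarget ρ t X) := by
  obtain ⟨hmeas', D, hD⟩ := hρ.map_into _ (memRt_projt hX (t + 1))
  obtain ⟨hmeas, C, hC⟩ := hX
  refine ⟨⟨fun s => ?_, max (max C D) 0, fun s ω => ?_⟩, fun r hr ω => ?_⟩
  · rcases lt_trichotomy s t with h | rfl | h
    · simp +unfoldPartialApp [oneStepTarget, h.ne, show ¬ t + 1 ≤ s by omega]
    · simpa +unfoldPartialApp [oneStepTarget] using hmeas s
    · have hs : t + 1 ≤ s := h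
      simpa +unfoldPartialApp [oneStepTarget, h.ne', hs] using hmeas'.mono (F.mono hs) le_rfl
  · unfold oneStepTarget
    split_ifs
    · exact (hC t ω).trans ((le_max_left C D).trans (le_max_left _ _))
    · rw [abs_neg]
      exact (hD ω).trans ((le_max_right C D).trans (le_max_left _ _))
    · simp
  · simp [oneStepTarget, hr.ne, show ¬ t + 1 ≤ r by omega]

lemma projt_of_memRt {m : MeasurableSpace Ω} {F : Filtration ℕ m} {t : ℕ} {X : ℕ → Ω → ℝ}
    (hX : MemRt F t X) : projt t X = X := by
  funext r ω
  by_cases h : t ≤ r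
  · simp [projt, h]
  · simp [projt, h, hX.2 r (not_le.mp h) ω]

/-- The one-step target of `X` has the same risk at time `t + 1` as `X` itself. -/
lemma risk_succ_oneStepTarget {m : MeasurableSpace Ω} {F : Filtration ℕ m} {P : Measure Ω}
    {ρ : ℕ → (ℕ → Ω → ℝ) → Ω → ℝ} {t : ℕ} (hρ : IsCondRiskMeasure F P (t + 1) (ρ (t + 1)))
    {X : ℕ → Ω → ℝ} (hX : MemRinf F X) :
    ρ (t + 1) (projt (t + 1) (oneStepTarget ρ t X)) =ᵐ[P] ρ (t + 1) (projt (t + 1) X) := by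
  obtain ⟨hmeas, D, hD⟩ := hρ.map_into _ (memRt_projt hX (t + 1))
  have hzero : MemRt F (t + 1) (fun _ _ => (0 : ℝ)) :=
    ⟨⟨fun _ => measurable_const, 0, by simp⟩, by simp⟩
  have hcash := hρ.cash _ hzero (fun ω => -ρ (t + 1) (projt (t + 1) X) ω)
    ⟨hmeas.neg, D, fun ω => by simpa using hD ω⟩
  have htarget : projt (t + 1) (oneStepTarget ρ t X) =
      fun r ω => (0 : ℝ) + if t + 1 ≤ r then -ρ (t + 1) (projt (t + 1) X) ω else 0 := by
    funext r ω
    by_cases h : t + 1 ≤ r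
    · simp [projt, oneStepTarget, h, show r ≠ t by omega]
    · simp [projt, h]
  rw [htarget]
  filter_upwards [hcash, hρ.norm] with ω h₁ h₂
  rw [h₁, h₂]
  simp

/-- **Time consistency is equivalent to recursiveness.**
A dynamic convex risk measure for processes `(ρ_t)` is time consistent if and only if for
every `t` and every `X ∈ ℛ^∞`,
`ρ_t(X) = ρ_t(X_t·1_{{t}} − ρ_{t+1}(X)·1_{𝕋_{t+1}})` `P`-a.s. -/
theorem stmt_7 {Ω : Type*} {m : MeasurableSpace Ω} (F : Filtration ℕ m)
    (P : Measure Ω) [IsProbabilityMeasure P]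
    (hF0 : ∀ A : Set Ω, MeasurableSet[F 0] A → P A = 0 ∨ P A = 1)
    (ρ : ℕ → (ℕ → Ω → ℝ) → Ω → ℝ)
    (hρ : ∀ t, IsCondRiskMeasure F P t (ρ t)) :
    TimeConsistent F P ρ ↔
      ∀ t, ∀ X : ℕ → Ω → ℝ, MemRinf F X →
        ρ t (projt t X) =ᵐ[P] ρ t (oneStepTarget ρ t X) := by
  constructor
  · intro hTC t X hX
    have hY := memRt_oneStepTarget (hρ (t + 1)) hX
    have hrisk := risk_succ_oneStepTarget (hρ (t + 1)) hX
    have ht : X t =ᵐ[P] oneStepTarget ρ t X t := .of_forall fun ω => by simp [oneStepTarget]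
    have hle := hTC t X _ hX hY.1 ht hrisk.symm.le
    have hge := hTC t _ X hY.1 hX ht.symm hrisk.le
    rw [projt_of_memRt hY] at hle hge
    filter_upwards [hle, hge] with ω h₁ h₂
    exact le_antisymm h₁ h₂
  · intro hrec t X Y hX hY ht hrisk
    have hmono := (hρ t).mono _ _ (memRt_oneStepTarget (hρ (t + 1)) hY)
      (memRt_oneStepTarget (hρ (t + 1)) hX) fun s => by
        filter_upwards [ht, hrisk] with ω h₁ h₂
        unfold oneStepTarget
        split_ifs
        · exact h₁.ge
        · exact neg_le_neg h₂
        · exact le_rfl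
    filter_upwards [hrec t X hX, hrec t Y hY, hmono] with ω h₁ h₂ h₃
    rw [h₁, h₂]
    exact h₃
end

section
/- With infinite time horizon 𝕋 = ℕ, there is no dynamic convex risk measure for processes (ρ_t)_{t∈ℕ} such that every ρ_t is continuous from above, every ρ_t is cash additive at time t+1 (i.e. ρ_t(X + m·1_{𝕋_{t+1}}) = ρ_t(X) − m P-a.s. for all X ∈ ℛ_t^∞, m ∈ L^∞_t), and (ρ_t) is time consistent. Equivalently, a dynamic convex risk measure with each ρ_t continuous from above and cash additive at time t+1 cannot be time consistent. -/
open MeasureTheory Filter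

variable {Ω : Type*}

/-- Continuity from above of `ρ_t`: for processes `Xⁿ ∈ ℛ^∞` with `Xⁿ_s ↓ X_s` a.s. for
every `s ≥ t`, one has `ρ_t(Xⁿ) ↑ ρ_t(X)` a.s. -/
def ContinuousFromAbove {m : MeasurableSpace Ω} (F : Filtration ℕ m) (P : Measure Ω)
    (t : ℕ) (ρ : (ℕ → Ω → ℝ) → Ω → ℝ) : Prop :=
  ∀ (Xn : ℕ → ℕ → Ω → ℝ) (X : ℕ → Ω → ℝ),
    (∀ n, MemRinf F (Xn n)) → MemRinf F X →
    (∀ s, t ≤ s → ∀ᵐ ω ∂P,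
      Antitone (fun n => Xn n s ω) ∧ Tendsto (fun n => Xn n s ω) atTop (nhds (X s ω))) →
    ∀ᵐ ω ∂P,
      Monotone (fun n => ρ (projt t (Xn n)) ω) ∧
      Tendsto (fun n => ρ (projt t (Xn n)) ω) atTop (nhds (ρ (projt t X) ω))

/-- The process `1_{𝕋_u}`, equal to one from time `u` on and zero before. -/
def unitFrom (Ω : Type*) (u : ℕ) : ℕ → Ω → ℝ := fun r _ => if u ≤ r then 1 else 0

theorem memRinf_unitFrom {Ω : Type*} {m : MeasurableSpace Ω} (F : Filtration ℕ m) (u : ℕ) :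
    MemRinf F (unitFrom Ω u) := by
  refine ⟨fun s => measurable_const, 1, fun s ω => ?_⟩
  unfold unitFrom
  split_ifs <;> simp

theorem memRinf_zero {Ω : Type*} {m : MeasurableSpace Ω} (F : Filtration ℕ m) :
    MemRinf F (fun _ _ => 0) :=
  ⟨fun _ => measurable_const, 0, fun _ _ => by simp⟩

theorem projt_unitFrom {Ω : Type*} {t u : ℕ} (h : t ≤ u) :
    projt t (unitFrom Ω u) = fun r _ => 0 + if u ≤ r then 1 else 0 := by
  funext r ω
  simp only [projt, unitFrom, zero_add]
  split_ifs <;> first | rfl | omega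

/-- Under time consistency and cash additivity one step ahead, paying one unit from time
`t + k` on reduces the risk at time `t` by at least one, however large the delay `k`. -/
theorem TimeConsistent.risk_unitFrom_le {Ω : Type*} {m : MeasurableSpace Ω}
    {F : Filtration ℕ m} {P : Measure Ω} {ρ : ℕ → (ℕ → Ω → ℝ) → Ω → ℝ}
    (hρ : ∀ t, IsCondRiskMeasure F P t (ρ t))
    (hca1 : ∀ t, ∀ X : ℕ → Ω → ℝ, MemRt F t X → ∀ mf : Ω → ℝ, BddMeas (F t) mf →
      ρ t (fun r ω => X r ω + if t + 1 ≤ r then mf ω else 0) =ᵐ[P]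
        fun ω => ρ t X ω - mf ω)
    (htc : TimeConsistent F P ρ) (k t : ℕ) :
    ∀ᵐ ω ∂P, ρ t (projt t (unitFrom Ω (t + k))) ω ≤ -1 := by
  have hzero : ∀ t, MemRt F t (fun _ _ => 0) := fun t => ⟨memRinf_zero F, fun _ _ _ => rfl⟩
  have hone : ∀ t, BddMeas (F t) (fun _ : Ω => (1 : ℝ)) := fun t =>
    ⟨measurable_const, 1, fun _ => by simp⟩
  have hnow : ∀ t, ∀ᵐ ω ∂P, ρ t (projt t (unitFrom Ω t)) ω = -1 := fun t => by
    rw [projt_unitFrom le_rfl]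
    filter_upwards [(hρ t).cash _ (hzero t) _ (hone t), (hρ t).norm] with ω h h0
    rw [h, h0]
    simp
  induction k generalizing t with
  | zero => filter_upwards [hnow t] with ω h using h.le
  | succ k ih =>
    have hnext : ∀ᵐ ω ∂P, ρ t (projt t (unitFrom Ω (t + 1))) ω = -1 := by
      rw [projt_unitFrom (Nat.le_succ t)]
      filter_upwards [hca1 t _ (hzero t) _ (hone t), (hρ t).norm] with ω h h0
      rw [h, h0]
      simp
    have hle := htc t (unitFrom Ω (t + (k + 1))) (unitFrom Ω (t + 1))
      (memRinf_unitFrom F _) (memRinf_unitFrom F _)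
      (Eventually.of_forall fun ω => by simp [unitFrom]) (by
        have ih' := ih (t + 1)
        rw [show t + 1 + k = t + (k + 1) by omega] at ih'
        filter_upwards [ih', hnow (t + 1)] with ω h h1
        rwa [h1])
    filter_upwards [hle, hnext] with ω h h1
    rwa [h1] at h

/-- **With infinite horizon, cash additivity at time t+1 together with continuity from
above excludes time consistency:** a dynamic convex risk measure for processes whose
components are continuous from above and cash additive at time `t+1` cannot be time
consistent. -/
theorem stmt_14 {Ω : Type*} {m : MeasurableSpace Ω} (F : Filtration ℕ m)
    (P : Measure Ω) [IsProbabilityMeasure P]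
    (hF0 : ∀ A : Set Ω, MeasurableSet[F 0] A → P A = 0 ∨ P A = 1)
    (ρ : ℕ → (ℕ → Ω → ℝ) → Ω → ℝ)
    (hρ : ∀ t, IsCondRiskMeasure F P t (ρ t))
    (hcont : ∀ t, ContinuousFromAbove F P t (ρ t))
    (hca1 : ∀ t, ∀ X : ℕ → Ω → ℝ, MemRt F t X → ∀ mf : Ω → ℝ, BddMeas (F t) mf →
      ρ t (fun r ω => X r ω + if t + 1 ≤ r then mf ω else 0) =ᵐ[P]
        fun ω => ρ t X ω - mf ω) :
    ¬ TimeConsistent F P ρ := by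
  intro htc
  have hlim := hcont 0 (unitFrom Ω) (fun _ _ => 0) (memRinf_unitFrom F) (memRinf_zero F) (by
    refine fun s _ => Eventually.of_forall fun ω => ⟨fun a b hab => ?_, ?_⟩
    · simp only [unitFrom]
      split_ifs <;> first | omega | norm_num
    · refine tendsto_const_nhds.congr' ?_
      filter_upwards [eventually_gt_atTop s] with n hn
      simp [unitFrom, hn])
  have hle : ∀ᵐ ω ∂P, ∀ n, ρ 0 (projt 0 (unitFrom Ω n)) ω ≤ -1 := ae_all_iff.2 fun n => by
    simpa using htc.risk_unitFrom_le hρ hca1 n 0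
  have hproj : projt 0 (fun _ _ => 0) = (fun _ _ => 0 : ℕ → Ω → ℝ) := by
    funext r ω
    simp [projt]
  rw [hproj] at hlim
  obtain ⟨ω, ⟨-, hω⟩, hωle, h0⟩ := (hlim.and (hle.and (hρ 0).norm)).exists
  have := le_of_tendsto' hω hωle
  rw [h0] at this
  norm_num at this
end

section
/- Let (Ω, 𝒢, (ℱ_t)_{t∈ℕ}, P) be a filtered probability space and let U = (U_t)_{t∈ℕ} be a nonnegative P-supermartingale with respect to (ℱ_t) with U_0 = 1. Then there exist a nonnegative P-martingale M = (M_t)_{t∈ℕ} with M_0 = 1 and a process D = (D_t)_{t∈ℕ} with D_0 = 1, 0 ≤ D_{t+1} ≤ D_t P-a.s. for every t, and D_{t+1} ℱ_t-measurable for every t (i.e. D is predictable, nonnegative and non-increasing), such that U_t = M_t D_t P-a.s. for every t ∈ ℕ. -/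
open MeasureTheory Filter

/-- If `g ≥ 0` and `f` is measurable for the smaller σ-algebra, integrability of `f * μ[g|m]`
implies that of `f * g`. -/
theorem integrable_mul_of_integrable_mul_condExp {Ω : Type*} {m m₀ : MeasurableSpace Ω}
    {μ : Measure Ω} [IsFiniteMeasure μ] (hm : m ≤ m₀) {f g : Ω → ℝ}
    (hf : StronglyMeasurable[m] f) (hg : Integrable g μ) (hg_nonneg : 0 ≤ᵐ[μ] g)
    (hfg : Integrable (f * μ[g|m]) μ) : Integrable (f * g) μ := by
  have hc_nonneg : 0 ≤ᵐ[μ] μ[g|m] := condExp_nonneg hg_nonneg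
  have hf' : Measurable[m] fun ω => ‖f ω‖ₑ := hf.enorm
  have htrim : (μ.withDensity fun ω => ‖g ω‖ₑ).trim hm =
      (μ.withDensity fun ω => ‖(μ[g|m]) ω‖ₑ).trim hm := by
    refine @Measure.ext _ m _ _ fun s hs => ?_
    have key : ∀ h : Ω → ℝ, Integrable h μ → 0 ≤ᵐ[μ] h →
        ∫⁻ ω in s, ‖h ω‖ₑ ∂μ = ENNReal.ofReal (∫ ω in s, h ω ∂μ) := fun h hh h0 => by
      rw [ofReal_integral_eq_lintegral_ofReal hh.integrableOn (ae_restrict_of_ae h0)]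
      refine lintegral_congr_ae (ae_restrict_of_ae ?_)
      filter_upwards [h0] with ω hω using Real.enorm_of_nonneg hω
    rw [trim_measurableSet_eq hm hs, trim_measurableSet_eq hm hs,
      withDensity_apply _ (hm s hs), withDensity_apply _ (hm s hs), key g hg hg_nonneg,
      key _ integrable_condExp hc_nonneg, setIntegral_condExp hm hg hs]
  have hlint : ∫⁻ ω, ‖(f * g) ω‖ₑ ∂μ = ∫⁻ ω, ‖(f * μ[g|m]) ω‖ₑ ∂μ := by
    have key : ∀ h : Ω → ℝ, Integrable h μ → ∫⁻ ω, ‖(f * h) ω‖ₑ ∂μ =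
        ∫⁻ ω, ‖f ω‖ₑ ∂((μ.withDensity fun ω => ‖h ω‖ₑ).trim hm) := fun h hh => by
      rw [lintegral_trim hm hf', lintegral_withDensity_eq_lintegral_mul₀
        hh.aestronglyMeasurable.enorm (hf'.mono hm le_rfl).aemeasurable]
      simp [mul_comm]
    rw [key g hg, key _ integrable_condExp, htrim]
  refine ⟨(hf.mono hm).aestronglyMeasurable.mul hg.aestronglyMeasurable, ?_⟩
  rw [hasFiniteIntegral_iff_enorm, hlint]
  exact hfg.2

section ItoWatanabe

variable {Ω : Type*} {m : MeasurableSpace Ω}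

/-- The nonnegative part of the one-step prediction `E[U (t + 1) | F t]`. -/
noncomputable def nonnegPrediction (F : Filtration ℕ m) (P : Measure Ω) (U : ℕ → Ω → ℝ) (t : ℕ) :
    Ω → ℝ :=
  fun ω => max ((P[U (t + 1)|F t]) ω) 0

/-- The martingale factor: the product of the ratios `U (s + 1) / E[U (s + 1) | F s]`, where a
ratio with vanishing denominator is replaced by `1`. -/
noncomputable def martingaleFactor (F : Filtration ℕ m) (P : Measure Ω) (U : ℕ → Ω → ℝ) :
    ℕ → Ω → ℝ
  | 0 => 1
  | t + 1 => martingaleFactor F P U t * (nonnegPrediction F P U t)⁻¹ * U (t + 1) +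
      {ω | nonnegPrediction F P U t ω = 0}.indicator (martingaleFactor F P U t)

/-- The predictable factor: the product of the ratios `E[U (s + 1) | F s] / U s`. -/
noncomputable def predictableFactor (F : Filtration ℕ m) (P : Measure Ω) (U : ℕ → Ω → ℝ) :
    ℕ → Ω → ℝ
  | 0 => 1
  | t + 1 => predictableFactor F P U t * (nonnegPrediction F P U t / U t)

variable {F : Filtration ℕ m} {P : Measure Ω} {U : ℕ → Ω → ℝ}

theorem nonnegPrediction_nonneg (t : ℕ) (ω : Ω) : 0 ≤ nonnegPrediction F P U t ω :=
  le_max_right _ _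

theorem stronglyMeasurable_nonnegPrediction (t : ℕ) :
    StronglyMeasurable[F t] (nonnegPrediction F P U t) :=
  (stronglyMeasurable_condExp.measurable.max measurable_const).stronglyMeasurable

theorem nonnegPrediction_ae_eq (hU : ∀ t ω, 0 ≤ U t ω) (t : ℕ) :
    nonnegPrediction F P U t =ᵐ[P] P[U (t + 1)|F t] := by
  have h : 0 ≤ᵐ[P] P[U (t + 1)|F t] := condExp_nonneg (ae_of_all _ (hU (t + 1)))
  filter_upwards [h] with ω hω using max_eq_left hω

theorem martingaleFactor_nonneg (hU : ∀ t ω, 0 ≤ U t ω) (t : ℕ) (ω : Ω) :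
    0 ≤ martingaleFactor F P U t ω := by
  induction t with
  | zero => exact zero_le_one
  | succ t ih =>
    exact add_nonneg (mul_nonneg (mul_nonneg ih (inv_nonneg.2 (nonnegPrediction_nonneg t ω)))
      (hU _ ω)) (Set.indicator_apply_nonneg fun _ => ih)

theorem predictableFactor_nonneg (hU : ∀ t ω, 0 ≤ U t ω) (t : ℕ) (ω : Ω) :
    0 ≤ predictableFactor F P U t ω := by
  induction t with
  | zero => exact zero_le_one
  | succ t ih => exact mul_nonneg ih (div_nonneg (nonnegPrediction_nonneg t ω) (hU t ω))

theorem measurableSet_nonnegPrediction_eq_zero (t : ℕ) :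
    MeasurableSet[F t] {ω | nonnegPrediction F P U t ω = 0} :=
  (stronglyMeasurable_nonnegPrediction t).measurable (measurableSet_singleton 0)

theorem stronglyAdapted_martingaleFactor (hU : StronglyAdapted F U) :
    StronglyAdapted F (martingaleFactor F P U) := by
  intro t
  induction t with
  | zero => exact stronglyMeasurable_one
  | succ t ih =>
    have hle := F.mono t.le_succ
    exact (((ih.mono hle).mul
      ((stronglyMeasurable_nonnegPrediction t).measurable.inv.stronglyMeasurable.mono hle)).mul
      (hU (t + 1))).add
        ((ih.indicator (measurableSet_nonnegPrediction_eq_zero t)).mono hle)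

theorem measurable_predictableFactor_succ (hU : StronglyAdapted F U) (t : ℕ) :
    Measurable[F t] (predictableFactor F P U (t + 1)) := by
  have step : ∀ s, Measurable[F s] (predictableFactor F P U s) →
      Measurable[F s] (predictableFactor F P U (s + 1)) := fun s hs =>
    hs.mul ((stronglyMeasurable_nonnegPrediction s).measurable.div (hU s).measurable)
  induction t with
  | zero => exact step 0 measurable_const
  | succ t ih => exact step _ (ih.mono (F.mono t.le_succ) le_rfl)

theorem martingale_martingaleFactor [IsFiniteMeasure P] (hU_adapted : StronglyAdapted F U)
    (hU_int : ∀ t, Integrable (U t) P) (hU : ∀ t ω, 0 ≤ U t ω) :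
    Martingale (martingaleFactor F P U) F P := by
  have hM := stronglyAdapted_martingaleFactor (P := P) hU_adapted
  have hZ : ∀ t, StronglyMeasurable[F t]
      (martingaleFactor F P U t * (nonnegPrediction F P U t)⁻¹) := fun t =>
    (hM t).mul (stronglyMeasurable_nonnegPrediction t).measurable.inv.stronglyMeasurable
  have hZA : ∀ t, martingaleFactor F P U t * (nonnegPrediction F P U t)⁻¹ * P[U (t + 1)|F t]
      =ᵐ[P] {ω | nonnegPrediction F P U t ω = 0}ᶜ.indicator (martingaleFactor F P U t) :=
      fun t => by
    filter_upwards [nonnegPrediction_ae_eq (F := F) hU t] with ω hω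
    by_cases h : nonnegPrediction F P U t ω = 0
    · simp [h]
    · simp [h, ← hω]
  have hZU : ∀ t, Integrable (martingaleFactor F P U t) P →
      Integrable (martingaleFactor F P U t * (nonnegPrediction F P U t)⁻¹ * U (t + 1)) P :=
    fun t ht => integrable_mul_of_integrable_mul_condExp (F.le t) (hZ t) (hU_int _)
      (ae_of_all _ (hU _)) ((integrable_congr (hZA t)).2
        (ht.indicator (F.le t _ (measurableSet_nonnegPrediction_eq_zero t).compl)))
  have hW : ∀ t, Integrable (martingaleFactor F P U t) P →
      Integrable ({ω | nonnegPrediction F P U t ω = 0}.indicator (martingaleFactor F P U t)) P :=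
    fun t ht => ht.indicator (F.le t _ (measurableSet_nonnegPrediction_eq_zero t))
  have hint : ∀ t, Integrable (martingaleFactor F P U t) P := by
    intro t
    induction t with
    | zero => exact integrable_const 1
    | succ t ih => exact (hZU t ih).add (hW t ih)
  refine martingale_nat hM hint fun t => ?_
  have hadd := condExp_add (hZU t (hint t)) (hW t (hint t)) (F t)
  have hpull := condExp_mul_of_stronglyMeasurable_left (hZ t) (hZU t (hint t)) (hU_int (t + 1))
  rw [condExp_of_stronglyMeasurable (F.le t)
    ((hM t).indicator (measurableSet_nonnegPrediction_eq_zero t)) (hW t (hint t))] at hadd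
  refine EventuallyEq.symm (hadd.trans ?_)
  filter_upwards [hpull, hZA t] with ω h₁ h₂
  rw [Pi.add_apply, h₁, h₂, ← Pi.add_apply, Set.indicator_compl_add_self]

theorem predictableFactor_succ_ae_le (hU : Supermartingale U F P) (hU_nonneg : ∀ t ω, 0 ≤ U t ω)
    (t : ℕ) : predictableFactor F P U (t + 1) ≤ᵐ[P] predictableFactor F P U t := by
  filter_upwards [nonnegPrediction_ae_eq (F := F) hU_nonneg t, hU.condExp_ae_le t.le_succ] with ω h₁ h₂
  exact mul_le_of_le_one_right (predictableFactor_nonneg hU_nonneg t ω)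
    (div_le_one_of_le₀ (h₁.trans_le h₂) (hU_nonneg t ω))

/-- A nonnegative process vanishes almost surely where its one-step prediction does. -/
theorem ae_eq_zero_of_nonnegPrediction_eq_zero [IsFiniteMeasure P]
    (hU_int : ∀ t, Integrable (U t) P) (hU : ∀ t ω, 0 ≤ U t ω) (t : ℕ) :
    ∀ᵐ ω ∂P, nonnegPrediction F P U t ω = 0 → U (t + 1) ω = 0 := by
  have hs := measurableSet_nonnegPrediction_eq_zero (F := F) (P := P) (U := U) t
  have h : ∫ ω in {ω | nonnegPrediction F P U t ω = 0}, U (t + 1) ω ∂P = 0 := by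
    rw [← setIntegral_condExp (F.le t) (hU_int (t + 1)) hs]
    refine setIntegral_eq_zero_of_ae_eq_zero ?_
    filter_upwards [nonnegPrediction_ae_eq hU t] with ω h₁ h₂
    exact h₁.symm.trans h₂
  rw [setIntegral_eq_zero_iff_of_nonneg_ae (ae_of_all _ (hU (t + 1)))
    (hU_int (t + 1)).integrableOn] at h
  exact (ae_restrict_iff' (F.le t _ hs)).1 h

theorem ae_eq_martingaleFactor_mul_predictableFactor [IsFiniteMeasure P]
    (hU : Supermartingale U F P) (hU_nonneg : ∀ t ω, 0 ≤ U t ω) (hU0 : ∀ ω, U 0 ω = 1) (t : ℕ) :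
    U t =ᵐ[P] fun ω => martingaleFactor F P U t ω * predictableFactor F P U t ω := by
  induction t with
  | zero => exact ae_of_all _ fun ω => by simp [martingaleFactor, predictableFactor, hU0]
  | succ t ih =>
    filter_upwards [ih, nonnegPrediction_ae_eq (F := F) hU_nonneg t, hU.condExp_ae_le t.le_succ,
      ae_eq_zero_of_nonnegPrediction_eq_zero (F := F) hU.integrable hU_nonneg t]
      with ω hω h₁ h₂ h₃
    by_cases h : nonnegPrediction F P U t ω = 0
    · simp [predictableFactor, h, h₃ h]
    · have hpos : 0 < U t ω :=
        ((nonnegPrediction_nonneg t ω).lt_of_ne' h).trans_le (h₁.trans_le h₂)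
      simp only [martingaleFactor, predictableFactor, Pi.add_apply, Pi.mul_apply, Pi.inv_apply,
        Pi.div_apply, Set.indicator, Set.mem_ofPred_eq, h, if_false, add_zero]
      field_simp
      rw [hω]
      ring

end ItoWatanabe

/-- **Discrete-time Itô–Watanabe factorization (existence).**
Every nonnegative supermartingale `U` with `U_0 = 1` factorizes as `U_t = M_t D_t` where
`M` is a nonnegative martingale with `M_0 = 1` and `D` is a predictable, nonnegative,
non-increasing process with `D_0 = 1`. -/
theorem stmt_17 {Ω : Type*} {m : MeasurableSpace Ω} (F : Filtration ℕ m)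
    (P : Measure Ω) [IsProbabilityMeasure P]
    (U : ℕ → Ω → ℝ) (hU : Supermartingale U F P)
    (hU_nonneg : ∀ t ω, 0 ≤ U t ω) (hU0 : ∀ ω, U 0 ω = 1) :
    ∃ M D : ℕ → Ω → ℝ,
      Martingale M F P ∧ (∀ t ω, 0 ≤ M t ω) ∧ (∀ ω, M 0 ω = 1) ∧
      (∀ ω, D 0 ω = 1) ∧
      (∀ t, ∀ᵐ ω ∂P, 0 ≤ D (t + 1) ω ∧ D (t + 1) ω ≤ D t ω) ∧
      (∀ t, Measurable[F t] (D (t + 1))) ∧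
      ∀ t, U t =ᵐ[P] fun ω => M t ω * D t ω := by
  exact ⟨martingaleFactor F P U, predictableFactor F P U,
    martingale_martingaleFactor hU.stronglyAdapted hU.integrable hU_nonneg,
    martingaleFactor_nonneg hU_nonneg, fun _ => rfl, fun _ => rfl,
    fun t => (predictableFactor_succ_ae_le hU hU_nonneg t).mono fun ω h =>
      ⟨predictableFactor_nonneg hU_nonneg (t + 1) ω, h⟩,
    measurable_predictableFactor_succ hU.stronglyAdapted,
    ae_eq_martingaleFactor_mul_predictableFactor hU hU_nonneg hU0⟩
end

section
/- Let (Ω, 𝒢, (ℱ_t)_{t∈ℕ}, P) be a filtered probability space and let U = (U_t)_{t∈ℕ} be a nonnegative P-supermartingale with U_0 = 1. Suppose U_t = M_t D_t = M'_t D'_t P-a.s. for all t, where M, M' are nonnegative P-martingales with M_0 = M'_0 = 1 and D, D' are predictable (D_{t+1}, D'_{t+1} are ℱ_t-measurable), nonnegative, non-increasing processes with D_0 = D'_0 = 1. Then for every t ∈ ℕ, on the event {U_s > 0 for all s with 1 ≤ s ≤ t} (i.e. {t < τ_0} where τ_0 := inf{s ≥ 1 : U_s = 0}), one has M_t = M'_t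 and D_t = D'_t P-a.s.; that is, the Itô–Watanabe decomposition of U is unique on {t < τ_0}. -/
open MeasureTheory Filter

/-- If `U = M * D` with `M` a martingale and `D` predictable, then
`E[U_{t+1} | ℱ_t] = M_t * D_{t+1}`. -/
lemma MeasureTheory.Martingale.condExp_succ_of_eq_mul {Ω : Type*} {m : MeasurableSpace Ω}
    {F : Filtration ℕ m} {P : Measure Ω} {U M D : ℕ → Ω → ℝ} {t : ℕ} (hM : Martingale M F P)
    (hU : Integrable (U (t + 1)) P) (hD : StronglyMeasurable[F t] (D (t + 1)))
    (h : U (t + 1) =ᵐ[P] fun ω => M (t + 1) ω * D (t + 1) ω) :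
    P[U (t + 1) | F t] =ᵐ[P] fun ω => M t ω * D (t + 1) ω := by
  have hpull : P[M (t + 1) * D (t + 1) | F t] =ᵐ[P] P[M (t + 1) | F t] * D (t + 1) :=
    condExp_mul_of_stronglyMeasurable_right hD (hU.congr h) (hM.integrable (t + 1))
  have hcond : P[U (t + 1) | F t] =ᵐ[P] P[M (t + 1) * D (t + 1) | F t] := condExp_congr_ae h
  filter_upwards [hcond, hpull, hM.condExp_ae_eq t.le_succ] with ω h₁ h₂ h₃
  rw [h₁, h₂, Pi.mul_apply, h₃]

/-- **Discrete-time Itô–Watanabe factorization (uniqueness).**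
If a nonnegative supermartingale `U` with `U_0 = 1` admits two factorizations
`U_t = M_t D_t = M'_t D'_t` with `M, M'` nonnegative martingales starting at `1` and
`D, D'` predictable nonnegative non-increasing processes starting at `1`, then for every
`t`, almost surely on the event `{t < τ₀} = {U_s > 0 for all 1 ≤ s ≤ t}` one has
`M_t = M'_t` and `D_t = D'_t`. -/
theorem stmt_18 {Ω : Type*} {m : MeasurableSpace Ω} (F : Filtration ℕ m)
    (P : Measure Ω) [IsProbabilityMeasure P]
    (U M M' D D' : ℕ → Ω → ℝ)
    (hU : Supermartingale U F P) (hU_nonneg : ∀ t ω, 0 ≤ U t ω) (hU0 : ∀ ω, U 0 ω = 1)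
    (hM : Martingale M F P) (hM' : Martingale M' F P)
    (hM_nonneg : ∀ t ω, 0 ≤ M t ω) (hM'_nonneg : ∀ t ω, 0 ≤ M' t ω)
    (hM0 : ∀ ω, M 0 ω = 1) (hM'0 : ∀ ω, M' 0 ω = 1)
    (hD0 : ∀ ω, D 0 ω = 1) (hD'0 : ∀ ω, D' 0 ω = 1)
    (hD_nonneg : ∀ t ω, 0 ≤ D t ω) (hD'_nonneg : ∀ t ω, 0 ≤ D' t ω)
    (hD_anti : ∀ t ω, D (t + 1) ω ≤ D t ω) (hD'_anti : ∀ t ω, D' (t + 1) ω ≤ D' t ω)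
    (hD_pred : ∀ t, Measurable[F t] (D (t + 1))) (hD'_pred : ∀ t, Measurable[F t] (D' (t + 1)))
    (hUMD : ∀ t, U t =ᵐ[P] fun ω => M t ω * D t ω)
    (hUMD' : ∀ t, U t =ᵐ[P] fun ω => M' t ω * D' t ω) :
    ∀ t, ∀ᵐ ω ∂P,
      (∀ s, 1 ≤ s → s ≤ t → 0 < U s ω) → M t ω = M' t ω ∧ D t ω = D' t ω := by
  intro t
  induction t with
  | zero => exact .of_forall fun ω _ => ⟨by rw [hM0, hM'0], by rw [hD0, hD'0]⟩
  | succ t ih =>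
    filter_upwards [ih, hUMD t, hUMD (t + 1), hUMD' (t + 1),
      hM.condExp_succ_of_eq_mul (hU.integrable _) (hD_pred t).stronglyMeasurable (hUMD (t + 1)),
      hM'.condExp_succ_of_eq_mul (hU.integrable _) (hD'_pred t).stronglyMeasurable
        (hUMD' (t + 1))] with ω hih hUt hUs hUs' hc hc' hpos
    obtain ⟨hMt, -⟩ := hih fun s h1 hs => hpos s h1 (hs.trans t.le_succ)
    have hUt_pos : 0 < U t ω := by
      rcases Nat.eq_zero_or_pos t with rfl | ht
      · simp [hU0]
      · exact hpos t ht t.le_succ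
    have hM_ne : M t ω ≠ 0 := left_ne_zero_of_mul (hUt ▸ hUt_pos.ne')
    have hDs : D (t + 1) ω = D' (t + 1) ω :=
      mul_left_cancel₀ hM_ne (hc.symm.trans (hMt ▸ hc'))
    have hD_ne : D (t + 1) ω ≠ 0 :=
      right_ne_zero_of_mul (hUs ▸ (hpos (t + 1) (by lia) le_rfl).ne')
    exact ⟨mul_right_cancel₀ hD_ne (hUs.symm.trans (hDs ▸ hUs')), hDs⟩
end
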